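/- Let σ ∈ ℂ\{0}, p ∈ C¹([0,ℓ];ℝ), a ∈ C²([0,ℓ];ℝ) with a > 0 on [0,ℓ], and set Q = (0,T)×(0,ℓ) and P(t,x,D)z := σ∂_t z − a(x)∂_x²z + p(x)z. Let ψ ∈ C²(closure Q; ℝ) satisfy |∂_x ψ(t,x)| ≥ C > 0 on closure Q, and for λ > 0 set α(t,x) = e^{λψ(t,x)}. Then there exist a constant λ̂ > 0 and, for each λ ≥ λ̂, constants τ₀(λ) > 0 and C₁ > 0 such that for all τ ≥ τ₀(λ) and every z ∈ C^{1,2}(closure Q; ℂ) vanishing on the boundary ∂Q and with ∂_x z(t,0) = ∂_x z(t,ℓ) = 0 for 0 ≤ t ≤ T, one has the Carleman estimate ∫_Q ( τ|∂_x z|² + τ³|z|² ) e^{2τα} dx dt ≤ C₁ ∫_Q |P(t,x,D)z|² e^{2τα} dx dt. -/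

import Mathlib

open Set MeasureTheory intervalIntegral

noncomputable section

/-- `u` is of class `C^{1,2}` on `[0,T] × [0,ℓ]`, with `ut`, `ux`, `uxx` its
partial derivatives `∂ₜu`, `∂ₓu`, `∂ₓ²u`. -/
def IsC12 (T ℓ : ℝ) (u ut ux uxx : ℝ → ℝ → ℂ) : Prop :=
  (∀ t ∈ Icc (0:ℝ) T, ∀ x ∈ Icc (0:ℝ) ℓ,
      HasDerivWithinAt (fun s => u s x) (ut t x) (Icc 0 T) t ∧
      HasDerivWithinAt (fun y => u t y) (ux t x) (Icc 0 ℓ) x ∧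
      HasDerivWithinAt (fun y => ux t y) (uxx t x) (Icc 0 ℓ) x) ∧
  ContinuousOn (fun z : ℝ × ℝ => u z.1 z.2) (Icc 0 T ×ˢ Icc 0 ℓ) ∧
  ContinuousOn (fun z : ℝ × ℝ => ut z.1 z.2) (Icc 0 T ×ˢ Icc 0 ℓ) ∧
  ContinuousOn (fun z : ℝ × ℝ => ux z.1 z.2) (Icc 0 T ×ˢ Icc 0 ℓ) ∧
  ContinuousOn (fun z : ℝ × ℝ => uxx z.1 z.2) (Icc 0 T ×ˢ Icc 0 ℓ)

/-- Joint continuity on `[0,T] × [0,ℓ]` of a curried function. -/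
def ContRect (T ℓ : ℝ) (f : ℝ → ℝ → ℝ) : Prop :=
  ContinuousOn (fun z : ℝ × ℝ => f z.1 z.2) (Icc 0 T ×ˢ Icc 0 ℓ)

/-- `ft` is the time derivative of `f` on `[0,T] × [0,ℓ]`. -/
def DerivT (T ℓ : ℝ) (f ft : ℝ → ℝ → ℝ) : Prop :=
  ∀ t ∈ Icc (0:ℝ) T, ∀ x ∈ Icc (0:ℝ) ℓ, HasDerivWithinAt (fun s => f s x) (ft t x) (Icc 0 T) t

/-- `fx` is the space derivative of `f` on `[0,T] × [0,ℓ]`. -/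
def DerivX (T ℓ : ℝ) (f fx : ℝ → ℝ → ℝ) : Prop :=
  ∀ t ∈ Icc (0:ℝ) T, ∀ x ∈ Icc (0:ℝ) ℓ, HasDerivWithinAt (fun y => f t y) (fx t x) (Icc 0 ℓ) x

lemma ContRect.const {T ℓ : ℝ} (c : ℝ) : ContRect T ℓ (fun _ _ => c) := continuousOn_const

lemma ContRect.of_space {T ℓ : ℝ} {a : ℝ → ℝ} (ha : ContinuousOn a (Icc 0 ℓ)) :
    ContRect T ℓ (fun _ x => a x) :=
  ha.comp continuousOn_snd fun _ hz => hz.2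

lemma ContRect.add {T ℓ : ℝ} {f g : ℝ → ℝ → ℝ} (hf : ContRect T ℓ f) (hg : ContRect T ℓ g) :
    ContRect T ℓ (fun t x => f t x + g t x) := ContinuousOn.add hf hg

lemma ContRect.sub {T ℓ : ℝ} {f g : ℝ → ℝ → ℝ} (hf : ContRect T ℓ f) (hg : ContRect T ℓ g) :
    ContRect T ℓ (fun t x => f t x - g t x) := ContinuousOn.sub hf hg

lemma ContRect.mul {T ℓ : ℝ} {f g : ℝ → ℝ → ℝ} (hf : ContRect T ℓ f) (hg : ContRect T ℓ g) :
    ContRect T ℓ (fun t x => f t x * g t x) := ContinuousOn.mul hf hg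

lemma ContRect.neg {T ℓ : ℝ} {f : ℝ → ℝ → ℝ} (hf : ContRect T ℓ f) :
    ContRect T ℓ (fun t x => -f t x) := ContinuousOn.neg hf

lemma ContRect.pow {T ℓ : ℝ} {f : ℝ → ℝ → ℝ} (hf : ContRect T ℓ f) (n : ℕ) :
    ContRect T ℓ (fun t x => f t x ^ n) := ContinuousOn.pow hf n

lemma ContRect.exp {T ℓ : ℝ} {f : ℝ → ℝ → ℝ} (hf : ContRect T ℓ f) :
    ContRect T ℓ (fun t x => Real.exp (f t x)) := ContinuousOn.rexp hf

lemma ContRect.slice {T ℓ : ℝ} {f : ℝ → ℝ → ℝ} (hf : ContRect T ℓ f) {t : ℝ} (ht : t ∈ Icc 0 T) :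
    ContinuousOn (f t) (Icc 0 ℓ) :=
  ContinuousOn.comp (t := Icc (0:ℝ) T ×ˢ Icc (0:ℝ) ℓ) (g := fun z : ℝ × ℝ => f z.1 z.2)
    (f := fun x => (t, x)) hf (by fun_prop) fun _ hx => ⟨ht, hx⟩

lemma ContRect.slice_time {T ℓ : ℝ} {f : ℝ → ℝ → ℝ} (hf : ContRect T ℓ f) {x : ℝ}
    (hx : x ∈ Icc 0 ℓ) : ContinuousOn (fun t => f t x) (Icc 0 T) :=
  ContinuousOn.comp (t := Icc (0:ℝ) T ×ˢ Icc (0:ℝ) ℓ) (g := fun z : ℝ × ℝ => f z.1 z.2)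
    (f := fun t => (t, x)) hf (by fun_prop) fun _ ht => ⟨ht, hx⟩

lemma ContRect.exists_bound {T ℓ : ℝ} {f : ℝ → ℝ → ℝ} (hf : ContRect T ℓ f) :
    ∃ K, 0 ≤ K ∧ ∀ t ∈ Icc 0 T, ∀ x ∈ Icc 0 ℓ, |f t x| ≤ K := by
  obtain ⟨K, hK⟩ := (isCompact_Icc.prod isCompact_Icc).exists_bound_of_continuousOn hf
  exact ⟨max K 0, le_max_right _ _, fun t ht x hx => (hK (t, x) ⟨ht, hx⟩).trans (le_max_left _ _)⟩

lemma ContRect.integrableOn {T ℓ : ℝ} {f : ℝ → ℝ → ℝ} (hf : ContRect T ℓ f) :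
    IntegrableOn (fun z : ℝ × ℝ => f z.1 z.2) (Ioo 0 T ×ˢ Ioo 0 ℓ) :=
  (hf.integrableOn_compact (isCompact_Icc.prod isCompact_Icc)).mono_set
    (prod_mono Ioo_subset_Icc_self Ioo_subset_Icc_self)

lemma ContRect.setIntegral_eq {T ℓ : ℝ} (hℓ : 0 ≤ ℓ) (hT : 0 ≤ T) {f : ℝ → ℝ → ℝ}
    (hf : ContRect T ℓ f) :
    ∫ z in Ioo (0:ℝ) T ×ˢ Ioo (0:ℝ) ℓ, f z.1 z.2 = ∫ t in (0:ℝ)..T, ∫ x in (0:ℝ)..ℓ, f t x := by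
  rw [Measure.volume_eq_prod, setIntegral_prod _ hf.integrableOn, integral_of_le hT,
    integral_Ioc_eq_integral_Ioo]
  simp only [integral_of_le hℓ, integral_Ioc_eq_integral_Ioo]

lemma ContRect.intervalIntegrable_integral {T ℓ : ℝ} (hℓ : 0 ≤ ℓ) (hT : 0 ≤ T) {f : ℝ → ℝ → ℝ}
    (hf : ContRect T ℓ f) :
    IntervalIntegrable (fun t => ∫ x in (0:ℝ)..ℓ, f t x) volume 0 T := by
  have h := hf.integrableOn
  rw [IntegrableOn, Measure.volume_eq_prod, ← Measure.prod_restrict] at h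
  have h2 := h.integral_prod_left
  rw [intervalIntegrable_iff_integrableOn_Ioo_of_le hT]
  simpa only [IntegrableOn, integral_of_le hℓ, integral_Ioc_eq_integral_Ioo] using h2

lemma setIntegral_eq_zero_of_derivX {T ℓ : ℝ} (hℓ : 0 ≤ ℓ) (hT : 0 ≤ T) {f fx : ℝ → ℝ → ℝ}
    (hd : DerivX T ℓ f fx) (hc : ContRect T ℓ fx)
    (h0 : ∀ t ∈ Icc 0 T, f t 0 = 0) (h1 : ∀ t ∈ Icc 0 T, f t ℓ = 0) :
    ∫ z in Ioo (0:ℝ) T ×ˢ Ioo (0:ℝ) ℓ, fx z.1 z.2 = 0 := by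
  rw [hc.setIntegral_eq hℓ hT]
  have : ∀ t ∈ uIcc 0 T, ∫ x in (0:ℝ)..ℓ, fx t x = 0 := by
    intro t ht
    rw [uIcc_of_le hT] at ht
    rw [integral_eq_sub_of_hasDeriv_right_of_le hℓ
      (f := f t) (fun x hx => (hd t ht x hx).continuousWithinAt), h0 t ht, h1 t ht, sub_zero]
    · exact fun x hx => ((hd t ht x (Ioo_subset_Icc_self hx)).hasDerivAt
        (Icc_mem_nhds hx.1 hx.2)).hasDerivWithinAt
    · exact (hc.slice ht).intervalIntegrable_of_Icc hℓ
  rw [integral_congr this]; simp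

lemma setIntegral_eq_zero_of_hasDerivWithinAt_integral {T ℓ : ℝ} (hℓ : 0 ≤ ℓ) (hT : 0 ≤ T)
    {Φ : ℝ → ℝ} {g : ℝ → ℝ → ℝ} (hc : ContRect T ℓ g)
    (hd : ∀ t ∈ Icc 0 T, HasDerivWithinAt Φ (∫ x in (0:ℝ)..ℓ, g t x) (Icc 0 T) t)
    (h0 : Φ 0 = 0) (h1 : Φ T = 0) :
    ∫ z in Ioo (0:ℝ) T ×ˢ Ioo (0:ℝ) ℓ, g z.1 z.2 = 0 := by
  rw [hc.setIntegral_eq hℓ hT, integral_eq_sub_of_hasDeriv_right_of_le hT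
      (f := Φ) (fun x hx => (hd x hx).continuousWithinAt), h0, h1, sub_zero]
  · exact fun x hx => ((hd x (Ioo_subset_Icc_self hx)).hasDerivAt
        (Icc_mem_nhds hx.1 hx.2)).hasDerivWithinAt
  · exact hc.intervalIntegrable_integral hℓ hT

/-- Passage to the limit in a time difference quotient tested against a continuous function. -/
lemma tendsto_integral_slope_mul {T ℓ : ℝ} (hℓ : 0 ≤ ℓ) {f ft g : ℝ → ℝ → ℝ}
    (hd : DerivT T ℓ f ft) (hf : ContRect T ℓ f) (hft : ContRect T ℓ ft) (hg : ContRect T ℓ g)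
    {t : ℝ} (ht : t ∈ Icc 0 T) :
    Filter.Tendsto (fun s => ∫ x in (0:ℝ)..ℓ, slope (fun r => f r x) t s * g s x)
      (nhdsWithin t (Icc 0 T \ {t})) (nhds (∫ x in (0:ℝ)..ℓ, ft t x * g t x)) := by
  obtain ⟨K, hK0, hK⟩ := hft.exists_bound
  obtain ⟨M, hM0, hM⟩ := hg.exists_bound
  have hmem : ∀ᶠ s in nhdsWithin t (Icc 0 T \ {t}), s ∈ Icc 0 T \ {t} := self_mem_nhdsWithin
  apply intervalIntegral.tendsto_integral_filter_of_dominated_convergence (fun _ => K * M)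
  · filter_upwards [hmem] with s hs
    refine ContinuousOn.aestronglyMeasurable ?_ measurableSet_uIoc
    have h1 := hf.slice hs.1
    have h2 := hf.slice ht
    have h3 := hg.slice hs.1
    rw [uIoc_of_le hℓ]
    refine ContinuousOn.mono ?_ Ioc_subset_Icc_self
    simp only [slope_def_field]
    exact ((h1.sub h2).div_const _).mul h3
  · filter_upwards [hmem] with s hs
    refine Filter.Eventually.of_forall fun x hx => ?_
    rw [uIoc_of_le hℓ] at hx
    have hx' := Ioc_subset_Icc_self hx
    have := (convex_Icc (0:ℝ) T).norm_image_sub_le_of_norm_hasDerivWithin_le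
      (f := fun r => f r x) (f' := fun r => ft r x) (C := K)
      (fun r hr => hd r hr x hx') (fun r hr => hK r hr x hx') ht hs.1
    rw [norm_mul]
    refine mul_le_mul ?_ (hM s hs.1 x hx') (norm_nonneg _) hK0
    rw [slope_def_field, norm_div]
    exact div_le_of_le_mul₀ (norm_nonneg _) hK0 this
  · exact intervalIntegrable_const
  · refine Filter.Eventually.of_forall fun x hx => ?_
    rw [uIoc_of_le hℓ] at hx
    have hx' := Ioc_subset_Icc_self hx
    refine Filter.Tendsto.mul ((hasDerivWithinAt_iff_tendsto_slope).1 (hd t ht x hx')) ?_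
    exact ((hg.slice_time hx') t ht).mono_left (nhdsWithin_mono _ sdiff_subset)

lemma integral_mul_derivX_eq {ℓ : ℝ} (hℓ : 0 ≤ ℓ) {f fx h hx : ℝ → ℝ}
    (hf : ∀ x ∈ Icc 0 ℓ, HasDerivWithinAt f (fx x) (Icc 0 ℓ) x)
    (hh : ∀ x ∈ Icc 0 ℓ, HasDerivWithinAt h (hx x) (Icc 0 ℓ) x)
    (hfx : ContinuousOn fx (Icc 0 ℓ)) (hhx : ContinuousOn hx (Icc 0 ℓ))
    (h0 : h 0 = 0) (h1 : h ℓ = 0) :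
    ∫ x in (0:ℝ)..ℓ, f x * hx x = - ∫ x in (0:ℝ)..ℓ, fx x * h x := by
  rw [integral_mul_deriv_eq_deriv_mul_of_hasDerivWithinAt (u' := fx) (v := h)]
  · simp [h0, h1]
  · rwa [uIcc_of_le hℓ]
  · rwa [uIcc_of_le hℓ]
  · exact hfx.intervalIntegrable_of_Icc hℓ
  · exact hhx.intervalIntegrable_of_Icc hℓ

/-- `f` is of class `C¹` on `[0,T] × [0,ℓ]`, with partial derivatives `ft` and `fx`. -/
structure IsC1Rect (T ℓ : ℝ) (f ft fx : ℝ → ℝ → ℝ) : Prop where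
  derivT : DerivT T ℓ f ft
  derivX : DerivX T ℓ f fx
  cont : ContRect T ℓ f
  contT : ContRect T ℓ ft
  contX : ContRect T ℓ fx

lemma IsC1Rect.mul {T ℓ : ℝ} {f ft fx g gt gx : ℝ → ℝ → ℝ} (hf : IsC1Rect T ℓ f ft fx)
    (hg : IsC1Rect T ℓ g gt gx) :
    IsC1Rect T ℓ (fun t x => f t x * g t x) (fun t x => ft t x * g t x + f t x * gt t x)
      (fun t x => fx t x * g t x + f t x * gx t x) where
  derivT t ht x hx := (hf.derivT t ht x hx).fun_mul (hg.derivT t ht x hx)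
  derivX t ht x hx := (hf.derivX t ht x hx).fun_mul (hg.derivX t ht x hx)
  cont := hf.cont.mul hg.cont
  contT := (hf.contT.mul hg.cont).add (hf.cont.mul hg.contT)
  contX := (hf.contX.mul hg.cont).add (hf.cont.mul hg.contX)

lemma IsC1Rect.of_space {T ℓ : ℝ} {a a' : ℝ → ℝ}
    (ha : ∀ x ∈ Icc (0:ℝ) ℓ, HasDerivWithinAt a (a' x) (Icc 0 ℓ) x)
    (ha' : ContinuousOn a' (Icc 0 ℓ)) :
    IsC1Rect T ℓ (fun _ x => a x) (fun _ _ => 0) (fun _ x => a' x) where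
  derivT t _ x _ := hasDerivWithinAt_const t _ (a x)
  derivX _ _ x hx := ha x hx
  cont := .of_space fun x hx => (ha x hx).continuousWithinAt
  contT := .const 0
  contX := .of_space ha'

/-- Symmetry of mixed derivatives in weak form: `∬ (∂ₜf ∂ₓh - ∂ₓf ∂ₜh) = 0`. -/
lemma setIntegral_jacobian_eq_zero {T ℓ : ℝ} (hℓ : 0 ≤ ℓ) (hT : 0 ≤ T)
    {f ft fx h ht hx : ℝ → ℝ → ℝ} (hf : IsC1Rect T ℓ f ft fx) (hh : IsC1Rect T ℓ h ht hx)
    (h0 : ∀ t ∈ Icc 0 T, h t 0 = 0) (h1 : ∀ t ∈ Icc 0 T, h t ℓ = 0)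
    (f0 : ∀ x ∈ Icc 0 ℓ, f 0 x = 0) (f1 : ∀ x ∈ Icc 0 ℓ, f T x = 0) :
    ∫ z in Ioo (0:ℝ) T ×ˢ Ioo (0:ℝ) ℓ,
      (ft z.1 z.2 * hx z.1 z.2 - fx z.1 z.2 * ht z.1 z.2) = 0 := by
  refine setIntegral_eq_zero_of_hasDerivWithinAt_integral hℓ hT
    (Φ := fun t => ∫ x in (0:ℝ)..ℓ, f t x * hx t x)
    (g := fun t x => ft t x * hx t x - fx t x * ht t x)
    ((hf.contT.mul hh.contX).sub (hf.contX.mul hh.contT)) ?_ ?_ ?_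
  · intro t htm
    rw [hasDerivWithinAt_iff_tendsto_slope]
    have e1 := tendsto_integral_slope_mul hℓ hf.derivT hf.cont hf.contT hh.contX htm
    have e2 := tendsto_integral_slope_mul hℓ (g := fun _ x => fx t x) hh.derivT hh.cont hh.contT
      (.of_space (hf.contX.slice htm)) htm
    have hint : ∀ {φ ψ : ℝ → ℝ}, ContinuousOn φ (Icc 0 ℓ) → ContinuousOn ψ (Icc 0 ℓ) →
      IntervalIntegrable (fun x => φ x * ψ x) volume 0 ℓ :=
      fun hφ hψ => (hφ.mul hψ).intervalIntegrable_of_Icc hℓ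
    rw [integral_sub (hint (hf.contT.slice htm) (hh.contX.slice htm))
      (hint (hf.contX.slice htm) (hh.contT.slice htm))]
    have e3 := e1.sub e2
    simp only [mul_comm (ht t _)] at e3
    refine e3.congr' ?_
    filter_upwards [self_mem_nhdsWithin] with s hs
    have cf := hf.cont.slice hs.1
    have cft := hf.cont.slice htm
    have ch := hh.cont.slice hs.1
    have cht := hh.cont.slice htm
    have chx := hh.contX.slice hs.1
    have chxt := hh.contX.slice htm
    have ip := integral_mul_derivX_eq hℓ (f := f t) (fx := fx t)
      (h := fun x => h s x - h t x) (hx := fun x => hx s x - hx t x) (hf.derivX t htm)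
      (fun x hx' => (hh.derivX s hs.1 x hx').fun_sub (hh.derivX t htm x hx'))
      (hf.contX.slice htm) (chx.sub chxt) (by simp [h0 s hs.1, h0 t htm])
      (by simp [h1 s hs.1, h1 t htm])
    simp only [slope_def_field, div_mul_eq_mul_div, intervalIntegral.integral_div]
    rw [← sub_div]
    congr 1
    rw [← integral_sub (hint cf chx) (hint cft chxt)]
    have : ∫ x in (0:ℝ)..ℓ, (h s x - h t x) * fx t x =
        ∫ x in (0:ℝ)..ℓ, fx t x * (h s x - h t x) := by simp only [mul_comm]
    rw [this, sub_eq_add_neg, ← ip, ← integral_add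
      (by exact hint (cf.sub cft) chx) (by exact hint cft (chx.sub chxt))]
    exact integral_congr fun x _ => by ring
  · refine (integral_congr (g := fun _ => (0:ℝ)) fun x hx => ?_).trans (by simp)
    rw [uIcc_of_le hℓ] at hx
    simp [f0 x hx]
  · refine (integral_congr (g := fun _ => (0:ℝ)) fun x hx => ?_).trans (by simp)
    rw [uIcc_of_le hℓ] at hx
    simp [f1 x hx]

/-- Energy identity: `∬ ∂ₓ(a ∂ₓh) ∂ₜh = 0`. -/
lemma setIntegral_divergence_mul_derivT_eq_zero {T ℓ : ℝ} (hℓ : 0 ≤ ℓ) (hT : 0 ≤ T)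
    {a : ℝ → ℝ} {h ht hx kx : ℝ → ℝ → ℝ} (ha : ContinuousOn a (Icc 0 ℓ))
    (hh : IsC1Rect T ℓ h ht hx) (hk : DerivX T ℓ (fun t x => a x * hx t x) kx)
    (hkc : ContRect T ℓ kx)
    (h0 : ∀ t ∈ Icc 0 T, h t 0 = 0) (h1 : ∀ t ∈ Icc 0 T, h t ℓ = 0)
    (hx0 : ∀ x ∈ Icc 0 ℓ, hx 0 x = 0) (hx1 : ∀ x ∈ Icc 0 ℓ, hx T x = 0) :
    ∫ z in Ioo (0:ℝ) T ×ˢ Ioo (0:ℝ) ℓ, kx z.1 z.2 * ht z.1 z.2 = 0 := by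
  refine setIntegral_eq_zero_of_hasDerivWithinAt_integral hℓ hT
    (Φ := fun t => (-1/2) * ∫ x in (0:ℝ)..ℓ, a x * hx t x ^ 2)
    (g := fun t x => kx t x * ht t x) (hkc.mul hh.contT) ?_ ?_ ?_
  · intro t htm
    rw [hasDerivWithinAt_iff_tendsto_slope]
    have e1 := tendsto_integral_slope_mul hℓ (g := fun s x => kx s x + kx t x)
      hh.derivT hh.cont hh.contT (hkc.add (.of_space (hkc.slice htm))) htm
    have e2 := e1.const_mul (1/2 : ℝ)
    have : (1/2 : ℝ) * ∫ x in (0:ℝ)..ℓ, ht t x * (kx t x + kx t x) =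
        ∫ x in (0:ℝ)..ℓ, kx t x * ht t x := by
      rw [← intervalIntegral.integral_const_mul]
      exact integral_congr fun x _ => by ring
    rw [this] at e2
    refine e2.congr' ?_
    filter_upwards [self_mem_nhdsWithin] with s hs
    have chx := hh.contX.slice hs.1
    have chxt := hh.contX.slice htm
    have ip := integral_mul_derivX_eq hℓ (f := fun x => a x * hx s x + a x * hx t x)
      (fx := fun x => kx s x + kx t x)
      (h := fun x => h s x - h t x) (hx := fun x => hx s x - hx t x)
      (fun x hx' => (hk s hs.1 x hx').fun_add (hk t htm x hx'))
      (fun x hx' => (hh.derivX s hs.1 x hx').fun_sub (hh.derivX t htm x hx'))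
      ((hkc.slice hs.1).add (hkc.slice htm)) (chx.sub chxt) (by simp [h0 s hs.1, h0 t htm])
      (by simp [h1 s hs.1, h1 t htm])
    simp only [slope_def_field, div_mul_eq_mul_div, intervalIntegral.integral_div]
    have e3 : ∫ x in (0:ℝ)..ℓ, (h s x - h t x) * (kx s x + kx t x) =
        ∫ x in (0:ℝ)..ℓ, (kx s x + kx t x) * (h s x - h t x) := by simp only [mul_comm]
    have e4 : (∫ x in (0:ℝ)..ℓ, a x * hx s x ^ 2) - ∫ x in (0:ℝ)..ℓ, a x * hx t x ^ 2 =
        ∫ x in (0:ℝ)..ℓ, (a x * hx s x + a x * hx t x) * (hx s x - hx t x) := by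
      rw [← intervalIntegral.integral_sub
        (by exact (ha.mul (chx.pow 2)).intervalIntegrable_of_Icc hℓ)
        (by exact (ha.mul (chxt.pow 2)).intervalIntegrable_of_Icc hℓ)]
      exact integral_congr fun x _ => by ring
    rw [e3, sub_eq_iff_eq_add.1 e4, ip]; ring
  · rw [integral_congr (g := fun _ => (0:ℝ))]
    · simp
    · intro x hx
      rw [uIcc_of_le hℓ] at hx
      simp [hx0 x hx]
  · rw [integral_congr (g := fun _ => (0:ℝ))]
    · simp
    · intro x hx
      rw [uIcc_of_le hℓ] at hx
      simp [hx1 x hx]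

lemma setIntegral_eq_zero_of_derivT {T ℓ : ℝ} (hℓ : 0 ≤ ℓ) (hT : 0 ≤ T)
    {f ft : ℝ → ℝ → ℝ} (hd : DerivT T ℓ f ft) (hft : ContRect T ℓ ft) (hf : ContRect T ℓ f)
    (f0 : ∀ x ∈ Icc 0 ℓ, f 0 x = 0) (f1 : ∀ x ∈ Icc 0 ℓ, f T x = 0) :
    ∫ z in Ioo (0:ℝ) T ×ˢ Ioo (0:ℝ) ℓ, ft z.1 z.2 = 0 := by
  refine setIntegral_eq_zero_of_hasDerivWithinAt_integral hℓ hT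
    (Φ := fun t => ∫ x in (0:ℝ)..ℓ, f t x) hft ?_ ?_ ?_
  · intro t htm
    rw [hasDerivWithinAt_iff_tendsto_slope]
    have e1 := tendsto_integral_slope_mul hℓ (g := fun _ _ => 1)
      hd hf hft (.const 1) htm
    simp only [mul_one] at e1
    refine e1.congr' ?_
    filter_upwards [self_mem_nhdsWithin] with s hs
    simp only [slope_def_field, intervalIntegral.integral_div]
    rw [integral_sub ((hf.slice hs.1).intervalIntegrable_of_Icc hℓ)
      ((hf.slice htm).intervalIntegrable_of_Icc hℓ)]
  · refine (integral_congr (g := fun _ => (0:ℝ)) fun x hx => ?_).trans (by simp)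
    rw [uIcc_of_le hℓ] at hx
    simp [f0 x hx]
  · refine (integral_congr (g := fun _ => (0:ℝ)) fun x hx => ?_).trans (by simp)
    rw [uIcc_of_le hℓ] at hx
    simp [f1 x hx]

/-- The real part of the operator conjugated by `e^{τα}`, applied to `w = u + iv`: the arguments
`a₁, αt, αx, αxx` are the derivatives of the coefficient and of the weight. -/
def conjRe (s₁ s₂ τ a p αt αx αxx u ut ux uxx v vt : ℝ) : ℝ :=
  s₁ * (ut - τ * αt * u) - s₂ * (vt - τ * αt * v)
    - a * (uxx - 2 * τ * αx * ux - τ * αxx * u + τ ^ 2 * αx ^ 2 * u) + p * u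

/-- The imaginary part of the operator conjugated by `e^{τα}`, applied to `w = u + iv`. -/
def conjIm (s₁ s₂ τ a p αt αx αxx u ut v vt vx vxx : ℝ) : ℝ :=
  s₁ * (vt - τ * αt * v) + s₂ * (ut - τ * αt * u)
    - a * (vxx - 2 * τ * αx * vx - τ * αxx * v + τ ^ 2 * αx ^ 2 * v) + p * v

/-- The space derivative of the boundary flux in the Carleman identity. -/
def fluxX (τ a a₁ αx αxx b bx bxx u ux uxx v vx vxx : ℝ) : ℝ :=
  -(2 * τ * ((a₁ * b + a * bx) * (ux ^ 2 + vx ^ 2) + a * b * (2 * ux * uxx + 2 * vx * vxx)))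
    - 2 * τ * ((a₁ * bx + a * bxx) * (ux * u + vx * v)
      + a * bx * (uxx * u + ux * ux + (vxx * v + vx * vx)))
    - 2 * τ ^ 3 * (((a₁ * αx ^ 2 + a * (2 * αx * αxx)) * b + a * αx ^ 2 * bx) * (u ^ 2 + v ^ 2)
      + a * αx ^ 2 * b * (2 * u * ux + 2 * v * vx))

lemma carleman_pointwise {s₁ s₂ τ a a₁ p αt αx αxx αxt b bt bx bxx u ut ux uxx v vt vx vxx c K : ℝ}
    (hτ : 1 ≤ τ) (hK : 0 ≤ K) (hcK : 4 * K + 16 * K ^ 2 ≤ c * τ)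
    (h₁ : c ≤ 2 * a * bx - a₁ * b) (h₂ : c ≤ (2 * a * αx * αxx + a₁ * αx ^ 2) * b)
    (h₃ : |a * bxx| ≤ c / 4 * τ) (h₄ : |s₂ * bt| ≤ K) (h₅ : |s₁ * a * αx * αxt| ≤ K)
    (h₆ : |2 * τ * (a * αx - b) + a₁| ≤ K)
    (h₇ : |τ * (a * αxx - bx - s₁ * αt) + p| ≤ K * τ) (h₈ : |τ * s₂ * αt| ≤ K * τ) :
    c * (τ * (ux ^ 2 + vx ^ 2) + τ ^ 3 * (u ^ 2 + v ^ 2))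
      + (fluxX τ a a₁ αx αxx b bx bxx u ux uxx v vx vxx
        - 2 * s₁ * ((a₁ * ux + a * uxx) * ut) - 2 * s₁ * ((a₁ * vx + a * vxx) * vt)
        - 2 * s₂ * τ * ((bt * v + b * vt) * ux - (bx * v + b * vx) * ut)
        + 2 * s₂ * τ * ((bt * u + b * ut) * vx - (bx * u + b * ux) * vt)
        - s₁ * τ ^ 2 * (a * (2 * αx * αxt) * (u ^ 2 + v ^ 2)
          + a * αx ^ 2 * (2 * u * ut + 2 * v * vt)))
      ≤ 2 * (conjRe s₁ s₂ τ a p αt αx αxx u ut ux uxx v vt ^ 2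
        + conjIm s₁ s₂ τ a p αt αx αxx u ut v vt vx vxx ^ 2) := by
  obtain ⟨D, hD⟩ : ∃ r, r = fluxX τ a a₁ αx αxx b bx bxx u ux uxx v vx vxx
      - 2 * s₁ * ((a₁ * ux + a * uxx) * ut) - 2 * s₁ * ((a₁ * vx + a * vxx) * vt)
      - 2 * s₂ * τ * ((bt * v + b * vt) * ux - (bx * v + b * vx) * ut)
      + 2 * s₂ * τ * ((bt * u + b * ut) * vx - (bx * u + b * ux) * vt)
      - s₁ * τ ^ 2 * (a * (2 * αx * αxt) * (u ^ 2 + v ^ 2)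
          + a * αx ^ 2 * (2 * u * ut + 2 * v * vt)) := ⟨_, rfl⟩
  obtain ⟨r₁, hr₁⟩ : ∃ r, r = 2 * τ * (a * αx - b) + a₁ := ⟨_, rfl⟩
  obtain ⟨r₂, hr₂⟩ : ∃ r, r = τ * (a * αxx - bx - s₁ * αt) + p := ⟨_, rfl⟩
  obtain ⟨r₃, hr₃⟩ : ∃ r, r = τ * s₂ * αt := ⟨_, rfl⟩
  obtain ⟨A₁, hA₁⟩ : ∃ r, r = -s₂ * vt - (a₁ * ux + a * uxx) - τ ^ 2 * a * αx ^ 2 * u := ⟨_, rfl⟩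
  obtain ⟨A₂, hA₂⟩ : ∃ r, r = s₂ * ut - (a₁ * vx + a * vxx) - τ ^ 2 * a * αx ^ 2 * v := ⟨_, rfl⟩
  obtain ⟨B₁, hB₁⟩ : ∃ r, r = s₁ * ut + 2 * τ * b * ux + τ * bx * u := ⟨_, rfl⟩
  obtain ⟨B₂, hB₂⟩ : ∃ r, r = s₁ * vt + 2 * τ * b * vx + τ * bx * v := ⟨_, rfl⟩
  obtain ⟨R₁, hR₁⟩ : ∃ r, r = r₁ * ux + r₂ * u + r₃ * v := ⟨_, rfl⟩
  obtain ⟨R₂, hR₂⟩ : ∃ r, r = r₁ * vx + r₂ * v - r₃ * u := ⟨_, rfl⟩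
  have hF₁ : conjRe s₁ s₂ τ a p αt αx αxx u ut ux uxx v vt = A₁ + B₁ + R₁ := by
    rw [hA₁, hB₁, hR₁, hr₁, hr₂, hr₃, conjRe]; ring
  have hF₂ : conjIm s₁ s₂ τ a p αt αx αxx u ut v vt vx vxx = A₂ + B₂ + R₂ := by
    rw [hA₂, hB₂, hR₂, hr₁, hr₂, hr₃, conjIm]; ring
  have key : 2 * (A₁ * B₁ + A₂ * B₂) =
      D
      + 2 * τ * (2 * a * bx - a₁ * b) * (ux ^ 2 + vx ^ 2)
      + 2 * τ ^ 3 * ((2 * a * αx * αxx + a₁ * αx ^ 2) * b) * (u ^ 2 + v ^ 2)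
      + (a * bxx) * (2 * τ * (ux * u + vx * v)) + (s₂ * bt) * (2 * τ * (v * ux - u * vx))
      + 2 * (s₁ * a * αx * αxt) * (τ ^ 2 * (u ^ 2 + v ^ 2)) := by
    rw [hD, hA₁, hA₂, hB₁, hB₂, fluxX]; ring
  rw [hF₁, hF₂, ← hD]
  have hτ0 : 0 < τ := by linarith
  rw [← hr₁] at h₆
  rw [← hr₂] at h₇
  rw [← hr₃] at h₈
  have abs_mul_lower : ∀ {x y M N : ℝ}, |x| ≤ M → |y| ≤ N → -(M * N) ≤ x * y := by
    intro x y M N hx hy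
    have := mul_le_mul hx hy (abs_nonneg _) ((abs_nonneg _).trans hx)
    rw [← abs_mul] at this
    exact (abs_le.1 this).1
  have hW : 0 ≤ ux ^ 2 + vx ^ 2 := by positivity
  have hZ : 0 ≤ u ^ 2 + v ^ 2 := by positivity
  have young : ∀ x y z w : ℝ,
      |2 * τ * (x * z + y * w)| ≤ (x ^ 2 + y ^ 2) + τ ^ 2 * (z ^ 2 + w ^ 2) := by
    intro x y z w
    rw [abs_le]
    constructor
    · linarith [sq_nonneg (x + τ * z), sq_nonneg (y + τ * w)]
    · linarith [sq_nonneg (x - τ * z), sq_nonneg (y - τ * w)]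
  have q₁ := young ux vx u v
  have q₂ : |2 * τ * (v * ux - u * vx)| ≤ (ux ^ 2 + vx ^ 2) + τ ^ 2 * (u ^ 2 + v ^ 2) := by
    convert young ux vx v (-u) using 1 <;> ring_nf
  have q₃ : |τ ^ 2 * (u ^ 2 + v ^ 2)| ≤ τ ^ 2 * (u ^ 2 + v ^ 2) := by
    rw [abs_of_nonneg (by positivity)]
  have e₁ := abs_mul_lower h₃ q₁
  have e₂ := abs_mul_lower h₄ q₂
  have e₃ := abs_mul_lower h₅ q₃
  have e₄ := mul_le_mul_of_nonneg_left h₁ (mul_nonneg hτ0.le hW)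
  have e₅ := mul_le_mul_of_nonneg_left h₂ (mul_nonneg (pow_nonneg hτ0.le 3) hZ)
  have hr₁2 : r₁ ^ 2 ≤ K ^ 2 := sq_le_sq' (abs_le.1 h₆).1 (abs_le.1 h₆).2
  have hr₂2 : r₂ ^ 2 ≤ (K * τ) ^ 2 := sq_le_sq' (abs_le.1 h₇).1 (abs_le.1 h₇).2
  have hr₃2 : r₃ ^ 2 ≤ (K * τ) ^ 2 := sq_le_sq' (abs_le.1 h₈).1 (abs_le.1 h₈).2
  have e₆ : R₁ ^ 2 + R₂ ^ 2 ≤ 3 * K ^ 2 * (ux ^ 2 + vx ^ 2)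
      + 6 * (K * τ) ^ 2 * (u ^ 2 + v ^ 2) := by
    have s1 : R₁ ^ 2 + R₂ ^ 2 ≤ 3 * (r₁ ^ 2 * (ux ^ 2 + vx ^ 2)
        + (r₂ ^ 2 + r₃ ^ 2) * (u ^ 2 + v ^ 2)) := by
      have tri : ∀ x y z : ℝ, (x + y + z) ^ 2 ≤ 3 * (x ^ 2 + y ^ 2 + z ^ 2) := fun x y z => by
        linarith [sq_nonneg (x - y), sq_nonneg (x - z), sq_nonneg (y - z)]
      rw [hR₁, hR₂]
      linarith [tri (r₁ * ux) (r₂ * u) (r₃ * v), tri (r₁ * vx) (r₂ * v) (-(r₃ * u))]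
    have s2 := mul_le_mul_of_nonneg_right hr₁2 hW
    have s3 := mul_le_mul_of_nonneg_right hr₂2 hZ
    have s4 := mul_le_mul_of_nonneg_right hr₃2 hZ
    linarith
  have e₇ : (4 * K + 16 * K ^ 2) * ((ux ^ 2 + vx ^ 2) + τ ^ 2 * (u ^ 2 + v ^ 2)) ≤
      c * τ * ((ux ^ 2 + vx ^ 2) + τ ^ 2 * (u ^ 2 + v ^ 2)) :=
    mul_le_mul_of_nonneg_right hcK (by positivity)
  have e₈ : 2 * (A₁ * B₁ + A₂ * B₂) ≤ 2 * ((A₁ + B₁ + R₁) ^ 2 + (A₂ + B₂ + R₂) ^ 2)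
      + 2 * (R₁ ^ 2 + R₂ ^ 2) := by
    linarith [sq_nonneg (A₁ + B₁ + R₁ + R₁), sq_nonneg (A₂ + B₂ + R₂ + R₂),
      sq_nonneg A₁, sq_nonneg A₂, sq_nonneg B₁, sq_nonneg B₂]
  have p₁ : 0 ≤ K * (ux ^ 2 + vx ^ 2) := by positivity
  have p₂ : 0 ≤ K * (τ ^ 2 * (u ^ 2 + v ^ 2)) := by positivity
  have p₃ : 0 ≤ K ^ 2 * (ux ^ 2 + vx ^ 2) := by positivity
  have p₄ : 0 ≤ K ^ 2 * (τ ^ 2 * (u ^ 2 + v ^ 2)) := by positivity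
  rw [key] at e₈
  linarith

/-- `f` is continuous on `[0,T] × [0,ℓ]` and has integral zero. -/
def ZeroIntegral (T ℓ : ℝ) (f : ℝ → ℝ → ℝ) : Prop :=
  ContRect T ℓ f ∧ ∫ z in Ioo (0:ℝ) T ×ˢ Ioo (0:ℝ) ℓ, f z.1 z.2 = 0

lemma ZeroIntegral.add_mul {T ℓ : ℝ} {f g : ℝ → ℝ → ℝ} (hf : ZeroIntegral T ℓ f)
    (hg : ZeroIntegral T ℓ g) (k : ℝ) : ZeroIntegral T ℓ (fun t x => f t x + k * g t x) := by
  refine ⟨hf.1.add ((ContRect.const k).mul hg.1), ?_⟩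
  rw [MeasureTheory.integral_add hf.1.integrableOn (hg.1.integrableOn.const_mul k),
    MeasureTheory.integral_const_mul, hf.2, hg.2]
  simp

lemma ZeroIntegral.sub_mul {T ℓ : ℝ} {f g : ℝ → ℝ → ℝ} (hf : ZeroIntegral T ℓ f)
    (hg : ZeroIntegral T ℓ g) (k : ℝ) : ZeroIntegral T ℓ (fun t x => f t x - k * g t x) := by
  simpa only [neg_mul, ← sub_eq_add_neg] using hf.add_mul hg (-k)

lemma ZeroIntegral.const_mul_integral_le {T ℓ : ℝ} {E F g : ℝ → ℝ → ℝ} (hg : ZeroIntegral T ℓ g)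
    (hE : ContRect T ℓ E) (hF : ContRect T ℓ F) {c d : ℝ}
    (h : ∀ t ∈ Icc 0 T, ∀ x ∈ Icc 0 ℓ, c * E t x + g t x ≤ d * F t x) :
    c * ∫ z in Ioo (0:ℝ) T ×ˢ Ioo (0:ℝ) ℓ, E z.1 z.2
      ≤ d * ∫ z in Ioo (0:ℝ) T ×ˢ Ioo (0:ℝ) ℓ, F z.1 z.2 := by
  have hEi := hE.integrableOn.const_mul c
  have hFi := hF.integrableOn.const_mul d
  rw [← MeasureTheory.integral_const_mul, ← MeasureTheory.integral_const_mul,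
    show ∫ z in Ioo (0:ℝ) T ×ˢ Ioo (0:ℝ) ℓ, c * E z.1 z.2
      = ∫ z in Ioo (0:ℝ) T ×ˢ Ioo (0:ℝ) ℓ, (c * E z.1 z.2 + g z.1 z.2) by
        rw [MeasureTheory.integral_add hEi hg.1.integrableOn, hg.2, add_zero]]
  exact setIntegral_mono_on (hEi.add hg.1.integrableOn) hFi
    (measurableSet_Ioo.prod measurableSet_Ioo) fun z hz =>
      h z.1 (Ioo_subset_Icc_self hz.1) z.2 (Ioo_subset_Icc_self hz.2)

/-- The Carleman estimate for the conjugated function `w = u + iv`. -/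
lemma carleman_conjugated {T ℓ : ℝ} (hℓ : 0 ≤ ℓ) (hT : 0 ≤ T) {s₁ s₂ τ c K : ℝ}
    {a a₁ p : ℝ → ℝ} {αt αx αxx αxt b bt bx bxx u ut ux uxx v vt vx vxx : ℝ → ℝ → ℝ}
    (hτ : 1 ≤ τ) (hK : 0 ≤ K) (hcK : 4 * K + 16 * K ^ 2 ≤ c * τ)
    (ha : ∀ x ∈ Icc (0:ℝ) ℓ, HasDerivWithinAt a (a₁ x) (Icc 0 ℓ) x)
    (ha₁ : ContinuousOn a₁ (Icc 0 ℓ)) (hp : ContinuousOn p (Icc 0 ℓ))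
    (hαt : ContRect T ℓ αt) (hαx : IsC1Rect T ℓ αx αxt αxx)
    (hb : IsC1Rect T ℓ b bt bx) (hbx : DerivX T ℓ bx bxx) (hbxx : ContRect T ℓ bxx)
    (hu : IsC1Rect T ℓ u ut ux) (hux : DerivX T ℓ ux uxx) (huxx : ContRect T ℓ uxx)
    (hv : IsC1Rect T ℓ v vt vx) (hvx : DerivX T ℓ vx vxx) (hvxx : ContRect T ℓ vxx)
    (u0 : ∀ t ∈ Icc 0 T, u t 0 = 0) (uℓ : ∀ t ∈ Icc 0 T, u t ℓ = 0)
    (ux0 : ∀ t ∈ Icc 0 T, ux t 0 = 0) (uxℓ : ∀ t ∈ Icc 0 T, ux t ℓ = 0)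
    (v0 : ∀ t ∈ Icc 0 T, v t 0 = 0) (vℓ : ∀ t ∈ Icc 0 T, v t ℓ = 0)
    (vx0 : ∀ t ∈ Icc 0 T, vx t 0 = 0) (vxℓ : ∀ t ∈ Icc 0 T, vx t ℓ = 0)
    (u0' : ∀ x ∈ Icc 0 ℓ, u 0 x = 0) (uT : ∀ x ∈ Icc 0 ℓ, u T x = 0)
    (ux0' : ∀ x ∈ Icc 0 ℓ, ux 0 x = 0) (uxT : ∀ x ∈ Icc 0 ℓ, ux T x = 0)
    (v0' : ∀ x ∈ Icc 0 ℓ, v 0 x = 0) (vT : ∀ x ∈ Icc 0 ℓ, v T x = 0)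
    (vx0' : ∀ x ∈ Icc 0 ℓ, vx 0 x = 0) (vxT : ∀ x ∈ Icc 0 ℓ, vx T x = 0)
    (h₁ : ∀ t ∈ Icc 0 T, ∀ x ∈ Icc 0 ℓ, c ≤ 2 * a x * bx t x - a₁ x * b t x)
    (h₂ : ∀ t ∈ Icc 0 T, ∀ x ∈ Icc 0 ℓ,
      c ≤ (2 * a x * αx t x * αxx t x + a₁ x * αx t x ^ 2) * b t x)
    (h₃ : ∀ t ∈ Icc 0 T, ∀ x ∈ Icc 0 ℓ, |a x * bxx t x| ≤ c / 4 * τ)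
    (h₄ : ∀ t ∈ Icc 0 T, ∀ x ∈ Icc 0 ℓ, |s₂ * bt t x| ≤ K)
    (h₅ : ∀ t ∈ Icc 0 T, ∀ x ∈ Icc 0 ℓ, |s₁ * a x * αx t x * αxt t x| ≤ K)
    (h₆ : ∀ t ∈ Icc 0 T, ∀ x ∈ Icc 0 ℓ, |2 * τ * (a x * αx t x - b t x) + a₁ x| ≤ K)
    (h₇ : ∀ t ∈ Icc 0 T, ∀ x ∈ Icc 0 ℓ,
      |τ * (a x * αxx t x - bx t x - s₁ * αt t x) + p x| ≤ K * τ)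
    (h₈ : ∀ t ∈ Icc 0 T, ∀ x ∈ Icc 0 ℓ, |τ * s₂ * αt t x| ≤ K * τ) :
    c * ∫ z in Ioo (0:ℝ) T ×ˢ Ioo (0:ℝ) ℓ, (τ * (ux z.1 z.2 ^ 2 + vx z.1 z.2 ^ 2)
        + τ ^ 3 * (u z.1 z.2 ^ 2 + v z.1 z.2 ^ 2))
      ≤ 2 * ∫ z in Ioo (0:ℝ) T ×ˢ Ioo (0:ℝ) ℓ,
        (conjRe s₁ s₂ τ (a z.2) (p z.2) (αt z.1 z.2) (αx z.1 z.2) (αxx z.1 z.2)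
            (u z.1 z.2) (ut z.1 z.2) (ux z.1 z.2) (uxx z.1 z.2) (v z.1 z.2) (vt z.1 z.2) ^ 2
        + conjIm s₁ s₂ τ (a z.2) (p z.2) (αt z.1 z.2) (αx z.1 z.2) (αxx z.1 z.2)
            (u z.1 z.2) (ut z.1 z.2) (v z.1 z.2) (vt z.1 z.2) (vx z.1 z.2) (vxx z.1 z.2) ^ 2) := by
  have Ha : ContRect T ℓ fun _ x => a x := .of_space fun x hx => (ha x hx).continuousWithinAt
  have Ha₁ : ContRect T ℓ fun _ x => a₁ x := .of_space ha₁
  have Hp : ContRect T ℓ fun _ x => p x := .of_space hp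
  obtain ⟨-, -, cαx, cαxt, cαxx⟩ := id hαx
  obtain ⟨-, dbx, cb, cbt, cbx⟩ := id hb
  obtain ⟨-, dux, cu, cut, cux⟩ := id hu
  obtain ⟨-, dvx, cv, cvt, cvx⟩ := id hv
  have z₁ : ZeroIntegral T ℓ fun t x => fluxX τ (a x) (a₁ x) (αx t x) (αxx t x) (b t x) (bx t x)
      (bxx t x) (u t x) (ux t x) (uxx t x) (v t x) (vx t x) (vxx t x) := by
    have hc : ContRect T ℓ fun t x => fluxX τ (a x) (a₁ x) (αx t x) (αxx t x) (b t x) (bx t x)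
        (bxx t x) (u t x) (ux t x) (uxx t x) (v t x) (vx t x) (vxx t x) := by
      unfold fluxX
      repeat' first
        | with_reducible assumption
        | apply ContRect.pow
        | exact ContRect.const _
        | apply ContRect.sub
        | apply ContRect.add
        | apply ContRect.neg
        | apply ContRect.mul
    refine ⟨hc, setIntegral_eq_zero_of_derivX hℓ hT
      (f := fun t x => -(2 * τ * (a x * b t x * (ux t x ^ 2 + vx t x ^ 2)))
        - 2 * τ * (a x * bx t x * (ux t x * u t x + vx t x * v t x))
        - 2 * τ ^ 3 * (a x * αx t x ^ 2 * b t x * (u t x ^ 2 + v t x ^ 2))) ?_ hc ?_ ?_⟩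
    · intro t ht x hx
      have d_a := ha x hx
      have d_b := hb.derivX t ht x hx
      have d_bx := hbx t ht x hx
      have d_α := hαx.derivX t ht x hx
      have d_u := hu.derivX t ht x hx
      have d_ux := hux t ht x hx
      have d_v := hv.derivX t ht x hx
      have d_vx := hvx t ht x hx
      have e₁ := ((d_a.fun_mul d_b).fun_mul ((d_ux.fun_pow 2).fun_add (d_vx.fun_pow 2))).const_mul
        (2 * τ)
      have e₂ := ((d_a.fun_mul d_bx).fun_mul ((d_ux.fun_mul d_u).fun_add
        (d_vx.fun_mul d_v))).const_mul (2 * τ)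
      have e₃ := (((d_a.fun_mul (d_α.fun_pow 2)).fun_mul d_b).fun_mul ((d_u.fun_pow 2).fun_add
        (d_v.fun_pow 2))).const_mul (2 * τ ^ 3)
      refine ((e₁.fun_neg.fun_sub e₂).fun_sub e₃).congr_deriv ?_
      unfold fluxX
      push_cast
      ring
    · intro t ht
      simp [u0 t ht, v0 t ht, ux0 t ht, vx0 t ht]
    · intro t ht
      simp [uℓ t ht, vℓ t ht, uxℓ t ht, vxℓ t ht]
  have z₂ : ∀ {h ht hx hxx : ℝ → ℝ → ℝ}, IsC1Rect T ℓ h ht hx → DerivX T ℓ hx hxx →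
      ContRect T ℓ hxx → (∀ t ∈ Icc 0 T, h t 0 = 0) → (∀ t ∈ Icc 0 T, h t ℓ = 0) →
      (∀ x ∈ Icc 0 ℓ, hx 0 x = 0) → (∀ x ∈ Icc 0 ℓ, hx T x = 0) →
      ZeroIntegral T ℓ fun t x => (a₁ x * hx t x + a x * hxx t x) * ht t x := by
    intro h ht hx hxx hh hhx hhxx g0 g1 g2 g3
    have hc : ContRect T ℓ fun t x => a₁ x * hx t x + a x * hxx t x :=
      (Ha₁.mul hh.contX).add (Ha.mul hhxx)
    exact ⟨hc.mul hh.contT, setIntegral_divergence_mul_derivT_eq_zero hℓ hT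
      (fun x hx => (ha x hx).continuousWithinAt) hh
      (fun t htm x hxm => (ha x hxm).fun_mul (hhx t htm x hxm)) hc g0 g1 g2 g3⟩
  have z₃ : ∀ {g gt gx h ht hx : ℝ → ℝ → ℝ}, IsC1Rect T ℓ g gt gx → IsC1Rect T ℓ h ht hx →
      (∀ t ∈ Icc 0 T, h t 0 = 0) → (∀ t ∈ Icc 0 T, h t ℓ = 0) →
      (∀ x ∈ Icc 0 ℓ, g 0 x = 0) → (∀ x ∈ Icc 0 ℓ, g T x = 0) →
      ZeroIntegral T ℓ fun t x => (bt t x * g t x + b t x * gt t x) * hx t x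
        - (bx t x * g t x + b t x * gx t x) * ht t x := by
    intro g gt gx h ht hx hg hh g0 g1 g2 g3
    exact ⟨((hb.mul hg).contT.mul hh.contX).sub ((hb.mul hg).contX.mul hh.contT),
      setIntegral_jacobian_eq_zero hℓ hT (hb.mul hg) hh g0 g1 (fun x hx => by simp [g2 x hx])
        (fun x hx => by simp [g3 x hx])⟩
  have z₄ : ZeroIntegral T ℓ fun t x => a x * (2 * αx t x * αxt t x) * (u t x ^ 2 + v t x ^ 2)
      + a x * αx t x ^ 2 * (2 * u t x * ut t x + 2 * v t x * vt t x) := by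
    have hc : ContRect T ℓ fun t x => a x * (2 * αx t x * αxt t x) * (u t x ^ 2 + v t x ^ 2)
        + a x * αx t x ^ 2 * (2 * u t x * ut t x + 2 * v t x * vt t x) := by
      repeat' first
        | with_reducible assumption
        | apply ContRect.pow
        | exact ContRect.const _
        | apply ContRect.add
        | apply ContRect.mul
    refine ⟨hc, setIntegral_eq_zero_of_derivT hℓ hT
      (f := fun t x => a x * αx t x ^ 2 * (u t x ^ 2 + v t x ^ 2)) ?_ hc ?_ ?_ ?_⟩
    · intro t ht x hx
      have d_α := hαx.derivT t ht x hx
      have d_u := hu.derivT t ht x hx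
      have d_v := hv.derivT t ht x hx
      refine (((d_α.fun_pow 2).const_mul (a x)).fun_mul ((d_u.fun_pow 2).fun_add
        (d_v.fun_pow 2))).congr_deriv ?_
      push_cast
      ring
    · repeat' first
        | with_reducible assumption
        | apply ContRect.pow
        | apply ContRect.add
        | apply ContRect.mul
    · intro x hx
      simp [u0' x hx, v0' x hx]
    · intro x hx
      simp [uT x hx, vT x hx]
  have z := ((((z₁.sub_mul (z₂ hu hux huxx u0 uℓ ux0' uxT) (2 * s₁)).sub_mul
    (z₂ hv hvx hvxx v0 vℓ vx0' vxT) (2 * s₁)).sub_mul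
    (z₃ hv hu u0 uℓ v0' vT) (2 * s₂ * τ)).add_mul
    (z₃ hu hv v0 vℓ u0' uT) (2 * s₂ * τ)).sub_mul z₄ (s₁ * τ ^ 2)
  have hE : ContRect T ℓ fun t x => τ * (ux t x ^ 2 + vx t x ^ 2)
      + τ ^ 3 * (u t x ^ 2 + v t x ^ 2) := by
    repeat' first
      | with_reducible assumption
      | apply ContRect.pow
      | exact ContRect.const _
      | apply ContRect.add
      | apply ContRect.mul
  have hF : ContRect T ℓ fun t x =>
      conjRe s₁ s₂ τ (a x) (p x) (αt t x) (αx t x) (αxx t x)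
            (u t x) (ut t x) (ux t x) (uxx t x) (v t x) (vt t x) ^ 2
        + conjIm s₁ s₂ τ (a x) (p x) (αt t x) (αx t x) (αxx t x)
            (u t x) (ut t x) (v t x) (vt t x) (vx t x) (vxx t x) ^ 2 := by
    unfold conjRe conjIm
    repeat' first
      | with_reducible assumption
      | apply ContRect.pow
      | exact ContRect.const _
      | apply ContRect.sub
      | apply ContRect.add
      | apply ContRect.neg
      | apply ContRect.mul
  refine z.const_mul_integral_le hE hF fun t ht x hx => ?_
  exact carleman_pointwise hτ hK hcK (h₁ t ht x hx) (h₂ t ht x hx) (h₃ t ht x hx) (h₄ t ht x hx)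
    (h₅ t ht x hx) (h₆ t ht x hx) (h₇ t ht x hx) (h₈ t ht x hx)

lemma ContRect.exists_modulus {T ℓ : ℝ} {f : ℝ → ℝ → ℝ} (hf : ContRect T ℓ f) {ε : ℝ}
    (hε : 0 < ε) : ∃ η > 0, ∀ t ∈ Icc 0 T, ∀ x ∈ Icc 0 ℓ, ∀ y ∈ Icc 0 ℓ,
      |x - y| < η → |f t x - f t y| < ε := by
  have h := (isCompact_Icc.prod isCompact_Icc).uniformContinuousOn_of_continuous hf
  obtain ⟨η, hη, H⟩ := Metric.uniformContinuousOn_iff.1 h ε hε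
  refine ⟨η, hη, fun t ht x hx y hy hxy => ?_⟩
  have := H (t, x) ⟨ht, hx⟩ (t, y) ⟨ht, hy⟩
    (by rw [Prod.dist_eq, dist_self, Real.dist_eq]; exact max_lt hη hxy)
  rwa [Real.dist_eq] at this

/-- The spatial difference quotient of `f` with step `δ ℓ`, based at the contracted point
`(1 - δ) x` so that it is defined on all of `[0,ℓ]`. -/
def shiftQuot (δ ℓ : ℝ) (f : ℝ → ℝ → ℝ) (t x : ℝ) : ℝ :=
  (f t ((1 - δ) * x + δ * ℓ) - f t ((1 - δ) * x)) / (δ * ℓ)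

section shiftQuot

variable {δ T ℓ : ℝ} {f ft fx : ℝ → ℝ → ℝ}

lemma contract_mem (h0 : 0 < δ) (h1 : δ ≤ 1) {x : ℝ} (hx : x ∈ Icc 0 ℓ) :
    (1 - δ) * x ∈ Icc 0 ℓ := by
  constructor <;> nlinarith [hx.1, hx.2]

lemma contract_add_mem (h0 : 0 < δ) (h1 : δ ≤ 1) {x : ℝ} (hx : x ∈ Icc 0 ℓ) :
    (1 - δ) * x + δ * ℓ ∈ Icc 0 ℓ := by
  constructor <;> nlinarith [hx.1, hx.2]

lemma ContRect.shiftQuot (h0 : 0 < δ) (h1 : δ ≤ 1) (hf : ContRect T ℓ f) :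
    ContRect T ℓ (shiftQuot δ ℓ f) := by
  refine ContinuousOn.div_const (ContinuousOn.sub ?_ ?_) _
  · exact ContinuousOn.comp (t := Icc (0:ℝ) T ×ˢ Icc (0:ℝ) ℓ) (g := fun z : ℝ × ℝ => f z.1 z.2)
      (f := fun z : ℝ × ℝ => (z.1, (1 - δ) * z.2 + δ * ℓ)) hf (by fun_prop)
      fun _ hz => ⟨hz.1, contract_add_mem h0 h1 hz.2⟩
  · exact ContinuousOn.comp (t := Icc (0:ℝ) T ×ˢ Icc (0:ℝ) ℓ) (g := fun z : ℝ × ℝ => f z.1 z.2)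
      (f := fun z : ℝ × ℝ => (z.1, (1 - δ) * z.2)) hf (by fun_prop)
      fun _ hz => ⟨hz.1, contract_mem h0 h1 hz.2⟩

lemma DerivT.shiftQuot (h0 : 0 < δ) (h1 : δ ≤ 1) (hf : DerivT T ℓ f ft) :
    DerivT T ℓ (shiftQuot δ ℓ f) (shiftQuot δ ℓ ft) := fun t ht _ hx =>
  ((hf t ht _ (contract_add_mem h0 h1 hx)).fun_sub (hf t ht _ (contract_mem h0 h1 hx))).div_const _

lemma DerivX.shiftQuot (h0 : 0 < δ) (h1 : δ ≤ 1) (hf : DerivX T ℓ f fx) :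
    DerivX T ℓ (shiftQuot δ ℓ f) (fun t x => (1 - δ) * shiftQuot δ ℓ fx t x) := by
  intro t ht x hx
  have d₁ : HasDerivWithinAt (fun y : ℝ => (1 - δ) * y) (1 - δ) (Icc 0 ℓ) x := by
    simpa using (hasDerivWithinAt_id x (Icc 0 ℓ)).const_mul (1 - δ)
  have e₁ := (hf t ht _ (contract_add_mem h0 h1 hx)).comp x (d₁.add_const (δ * ℓ))
    fun y hy => contract_add_mem h0 h1 hy
  have e₂ := (hf t ht _ (contract_mem h0 h1 hx)).comp x d₁ fun y hy => contract_mem h0 h1 hy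
  refine ((e₁.sub e₂).div_const (δ * ℓ)).congr_deriv ?_
  simp only [_root_.shiftQuot]
  ring

/-- Mean value theorem for `shiftQuot`. -/
lemma DerivX.exists_shiftQuot_eq (h0 : 0 < δ) (h1 : δ ≤ 1) (hℓ : 0 < ℓ) (hf : DerivX T ℓ f fx)
    {t x : ℝ} (ht : t ∈ Icc 0 T) (hx : x ∈ Icc 0 ℓ) :
    ∃ ξ ∈ Icc 0 ℓ, |ξ - x| ≤ δ * ℓ ∧ _root_.shiftQuot δ ℓ f t x = fx t ξ := by
  have hδℓ : 0 < δ * ℓ := mul_pos h0 hℓ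
  have m₁ := contract_mem h0 h1 hx
  have m₂ := contract_add_mem h0 h1 hx
  obtain ⟨ξ, hξ, e⟩ := exists_hasDerivAt_eq_slope (f t) (fx t)
    (a := (1 - δ) * x) (b := (1 - δ) * x + δ * ℓ) (by linarith)
    (fun y hy => ((hf t ht y ⟨m₁.1.trans hy.1, hy.2.trans m₂.2⟩).continuousWithinAt).mono
      (Icc_subset_Icc m₁.1 m₂.2))
    (fun y hy => (hf t ht y ⟨m₁.1.trans hy.1.le, hy.2.le.trans m₂.2⟩).hasDerivAt
      (Icc_mem_nhds (m₁.1.trans_lt hy.1) (hy.2.trans_le m₂.2)))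
  refine ⟨ξ, ⟨m₁.1.trans hξ.1.le, hξ.2.le.trans m₂.2⟩, ?_, ?_⟩
  · have a1 : 0 ≤ δ * x := mul_nonneg h0.le hx.1
    have a2 : δ * x ≤ δ * ℓ := mul_le_mul_of_nonneg_left hx.2 h0.le
    rw [abs_le]
    constructor <;> linarith [hξ.1, hξ.2]
  · rw [e, _root_.shiftQuot, add_sub_cancel_left]

end shiftQuot

lemma abs_mul_le_mul {x y M N : ℝ} (hx : |x| ≤ M) (hy : |y| ≤ N) : |x * y| ≤ M * N := by
  rw [abs_mul]
  exact mul_le_mul hx hy (abs_nonneg _) ((abs_nonneg _).trans hx)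

/-- The multiplier coefficient: a regularisation of `a ∂ₓα` on the scale `1/τ` which has a second
space derivative of size `o(τ)`. -/
lemma exists_multiplier {T ℓ c₀ M s₁ s₂ : ℝ} (hℓ : 0 < ℓ) {a a₁ a₂ p : ℝ → ℝ}
    {α αt αx αxx αxt αtx : ℝ → ℝ → ℝ} (hc₀ : 0 < c₀) (hM : 1 ≤ M)
    (ha : ∀ x ∈ Icc (0:ℝ) ℓ, HasDerivWithinAt a (a₁ x) (Icc 0 ℓ) x)
    (ha₁ : ∀ x ∈ Icc (0:ℝ) ℓ, HasDerivWithinAt a₁ (a₂ x) (Icc 0 ℓ) x)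
    (ha₂ : ContinuousOn a₂ (Icc 0 ℓ))
    (hα : IsC1Rect T ℓ α αt αx) (hαx : IsC1Rect T ℓ αx αxt αxx) (hαtx : DerivX T ℓ αt αtx)
    (Ma : ∀ x ∈ Icc 0 ℓ, |a x| ≤ M) (Ma₁ : ∀ x ∈ Icc 0 ℓ, |a₁ x| ≤ M)
    (Ma₂ : ∀ x ∈ Icc 0 ℓ, |a₂ x| ≤ M) (Mp : ∀ x ∈ Icc 0 ℓ, |p x| ≤ M)
    (Mαt : ∀ t ∈ Icc 0 T, ∀ x ∈ Icc 0 ℓ, |αt t x| ≤ M)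
    (Mαx : ∀ t ∈ Icc 0 T, ∀ x ∈ Icc 0 ℓ, |αx t x| ≤ M)
    (Mαxx : ∀ t ∈ Icc 0 T, ∀ x ∈ Icc 0 ℓ, |αxx t x| ≤ M)
    (Mαxt : ∀ t ∈ Icc 0 T, ∀ x ∈ Icc 0 ℓ, |αxt t x| ≤ M)
    (Mαtx : ∀ t ∈ Icc 0 T, ∀ x ∈ Icc 0 ℓ, |αtx t x| ≤ M)
    (Ms₁ : |s₁| ≤ M) (Ms₂ : |s₂| ≤ M)
    (hlb : ∀ t ∈ Icc 0 T, ∀ x ∈ Icc 0 ℓ, c₀ ≤ |αx t x|)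
    (hpos : ∀ t ∈ Icc 0 T, ∀ x ∈ Icc 0 ℓ,
      c₀ ≤ 2 * a x ^ 2 * αxx t x + a x * a₁ x * αx t x) :
    ∃ c > 0, ∃ K ≥ 0, ∃ τ₀ ≥ 1, ∀ τ ≥ τ₀, 4 * K + 16 * K ^ 2 ≤ c * τ ∧
      ∃ b bt bx bxx : ℝ → ℝ → ℝ, IsC1Rect T ℓ b bt bx ∧ DerivX T ℓ bx bxx ∧ ContRect T ℓ bxx ∧
      ∀ t ∈ Icc 0 T, ∀ x ∈ Icc 0 ℓ, c ≤ 2 * a x * bx t x - a₁ x * b t x ∧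
        c ≤ (2 * a x * αx t x * αxx t x + a₁ x * αx t x ^ 2) * b t x ∧
        |a x * bxx t x| ≤ c / 4 * τ ∧ |s₂ * bt t x| ≤ K ∧
        |s₁ * a x * αx t x * αxt t x| ≤ K ∧
        |2 * τ * (a x * αx t x - b t x) + a₁ x| ≤ K ∧
        |τ * (a x * αxx t x - bx t x - s₁ * αt t x) + p x| ≤ K * τ ∧
        |τ * s₂ * αt t x| ≤ K * τ := by
  have hM0 : 0 < M := by linarith
  obtain ⟨c, hc, hc₁, hc₂⟩ : ∃ c > 0, c ≤ c₀ / 2 ∧ c ≤ c₀ ^ 2 / 2 * c₀ :=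
    ⟨min (c₀ / 2) (c₀ ^ 2 / 2 * c₀), by positivity, min_le_left _ _, min_le_right _ _⟩
  obtain ⟨ε, hε, hε₁, hε₂, hε₃⟩ : ∃ ε > 0, 3 * M ^ 2 * ε ≤ c₀ / 2 ∧ M * ε ≤ c₀ ^ 2 / 2 ∧
      M ^ 2 * ε ≤ c / 8 * ℓ := by
    refine ⟨min (c₀ / 2 / (3 * M ^ 2)) (min (c₀ ^ 2 / 2 / M) (c / 8 * ℓ / M ^ 2)),
      by positivity, ?_, ?_, ?_⟩
    · rw [← le_div_iff₀' (by positivity)]; exact min_le_left _ _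
    · rw [← le_div_iff₀' (by positivity)]; exact (min_le_right _ _).trans (min_le_left _ _)
    · rw [← le_div_iff₀' (by positivity)]; exact (min_le_right _ _).trans (min_le_right _ _)
  obtain ⟨η, hη, hmod⟩ := hαx.contX.exists_modulus (half_pos hε)
  obtain ⟨K, hK⟩ : ∃ K, K = 5 * M ^ 4 + 2 * M ^ 2 * ℓ := ⟨_, rfl⟩
  have hK0 : 0 ≤ K := by rw [hK]; positivity
  obtain ⟨τ₀, hτ₀1, hτ₀⟩ : ∃ τ₀ : ℝ, 1 ≤ τ₀ ∧ ∀ τ ≥ τ₀, 4 * K + 16 * K ^ 2 ≤ c * τ ∧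
      3 * M ^ 3 ≤ c / 8 * τ ∧ ℓ < η * τ ∧ M ≤ ε / 2 * τ ∧ M * ℓ ≤ ε * τ := by
    refine ⟨max 1 (max ((4 * K + 16 * K ^ 2) / c) (max (3 * M ^ 3 / (c / 8)) (max (ℓ / η + 1)
      (max (M / (ε / 2)) (M * ℓ / ε))))), le_max_left _ _, fun τ hτ => ?_⟩
    simp only [ge_iff_le, max_le_iff] at hτ
    obtain ⟨-, g1, g2, g3, g4, g5⟩ := hτ
    refine ⟨(div_le_iff₀' hc).1 g1, (div_le_iff₀' (by positivity)).1 g2,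
      (div_lt_iff₀' hη).1 (by linarith), (div_le_iff₀' (by positivity)).1 g4,
      (div_le_iff₀' hε).1 g5⟩
  refine ⟨c, hc, K, hK0, τ₀, hτ₀1, fun τ hτ => ?_⟩
  obtain ⟨g1, g2, g3, g4, g5⟩ := hτ₀ τ hτ
  refine ⟨g1, ?_⟩
  have hτ1 : 1 ≤ τ := hτ₀1.trans hτ
  have hτ0 : 0 < τ := by linarith
  have hδ0 : 0 < 1 / τ := by positivity
  have hδ1 : 1 / τ ≤ 1 := (div_le_one hτ0).2 hτ1
  have hδτ : τ * (1 / τ) = 1 := by field_simp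
  obtain ⟨δ, hδ⟩ : ∃ δ, δ = 1 / τ := ⟨_, rfl⟩
  rw [← hδ] at hδ0 hδ1 hδτ
  have hβ : IsC1Rect T ℓ (shiftQuot δ ℓ α) (shiftQuot δ ℓ αt)
      (fun t x => (1 - δ) * shiftQuot δ ℓ αx t x) :=
    ⟨hα.derivT.shiftQuot hδ0 hδ1, hα.derivX.shiftQuot hδ0 hδ1, hα.cont.shiftQuot hδ0 hδ1,
      hα.contT.shiftQuot hδ0 hδ1, (ContRect.const _).mul (hα.contX.shiftQuot hδ0 hδ1)⟩
  have hβx : DerivX T ℓ (fun t x => (1 - δ) * shiftQuot δ ℓ αx t x)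
      (fun t x => (1 - δ) * ((1 - δ) * shiftQuot δ ℓ αxx t x)) := fun t ht x hx =>
    (hαx.derivX.shiftQuot hδ0 hδ1 t ht x hx).const_mul _
  have hβxx : ContRect T ℓ (fun t x => (1 - δ) * ((1 - δ) * shiftQuot δ ℓ αxx t x)) :=
    (ContRect.const _).mul ((ContRect.const _).mul (hαx.contX.shiftQuot hδ0 hδ1))
  obtain ⟨β, hβe⟩ : ∃ β, β = shiftQuot δ ℓ α := ⟨_, rfl⟩
  obtain ⟨βt, hβte⟩ : ∃ β, β = shiftQuot δ ℓ αt := ⟨_, rfl⟩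
  obtain ⟨βx, hβxe⟩ : ∃ β, β = fun t x => (1 - δ) * shiftQuot δ ℓ αx t x := ⟨_, rfl⟩
  obtain ⟨βxx, hβxxe⟩ : ∃ β, β = fun t x => (1 - δ) * ((1 - δ) * shiftQuot δ ℓ αxx t x) :=
    ⟨_, rfl⟩
  rw [← hβe, ← hβte, ← hβxe] at hβ
  rw [← hβxe, ← hβxxe] at hβx
  rw [← hβxxe] at hβxx
  have ca₁ : ContinuousOn a₁ (Icc 0 ℓ) := fun x hx => (ha₁ x hx).continuousWithinAt
  have hA : IsC1Rect T ℓ (fun _ x => a x) (fun _ _ => 0) fun _ x => a₁ x := .of_space ha ca₁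
  have hA₁ : IsC1Rect T ℓ (fun _ x => a₁ x) (fun _ _ => 0) fun _ x => a₂ x := .of_space ha₁ ha₂
  refine ⟨_, _, _, fun t x => (a₂ x * β t x + a₁ x * βx t x) + (a₁ x * βx t x + a x * βxx t x),
    hA.mul hβ, fun t ht x hx => ?_, ?_, fun t ht x hx => ?_⟩
  · exact ((ha₁ x hx).fun_mul (hβ.derivX t ht x hx)).fun_add
      ((ha x hx).fun_mul (hβx t ht x hx))
  · exact ((hA₁.contX.mul hβ.cont).add (hA₁.cont.mul hβ.contX)).add
      ((hA₁.cont.mul hβ.contX).add (hA.cont.mul hβxx))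
  have hδℓ : δ * ℓ < η := by
    rw [hδ, div_mul_eq_mul_div, one_mul, div_lt_iff₀ hτ0]; exact g3
  have hβ_eq : ∃ ξ ∈ Icc 0 ℓ, |ξ - x| ≤ δ * ℓ ∧ β t x = αx t ξ := by
    rw [hβe]; exact hα.derivX.exists_shiftQuot_eq hδ0 hδ1 hℓ ht hx
  have hβt_eq : ∃ ξ ∈ Icc 0 ℓ, |ξ - x| ≤ δ * ℓ ∧ βt t x = αtx t ξ := by
    rw [hβte]; exact hαtx.exists_shiftQuot_eq hδ0 hδ1 hℓ ht hx
  obtain ⟨ξ, hξ, hξx, eξ⟩ := hβ_eq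
  obtain ⟨ζ, hζ, hζx, eζ⟩ := hαx.derivX.exists_shiftQuot_eq hδ0 hδ1 hℓ ht hx
  have Bβ : |β t x| ≤ M := eξ ▸ Mαx t ht ξ hξ
  have Bβt : |βt t x| ≤ M := by
    obtain ⟨θ, hθ, -, e⟩ := hβt_eq
    exact e ▸ Mαtx t ht θ hθ
  have eβx : βx t x = (1 - δ) * αxx t ζ := by rw [hβxe]; simp only [eζ]
  have h1δ : |1 - δ| ≤ 1 := by rw [abs_le]; constructor <;> linarith
  have Bβx : |βx t x| ≤ M := by
    rw [eβx]; simpa using abs_mul_le_mul h1δ (Mαxx t ht ζ hζ)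
  have Dβ : |αx t x - β t x| ≤ M * (δ * ℓ) := by
    rw [eξ]
    have := (convex_Icc (0:ℝ) ℓ).norm_image_sub_le_of_norm_hasDerivWithin_le
      (fun y hy => hαx.derivX t ht y hy) (fun y hy => Mαxx t ht y hy) hξ hx
    refine this.trans (mul_le_mul_of_nonneg_left ?_ hM0.le)
    rwa [Real.norm_eq_abs, abs_sub_comm]
  have Dβε : |αx t x - β t x| ≤ ε := by
    refine Dβ.trans ?_
    rw [hδ, one_div_mul_eq_div, mul_div_assoc', div_le_iff₀ hτ0]
    exact g5
  have Dβx : |αxx t x - βx t x| ≤ ε := by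
    have e1 : αxx t x - βx t x = -(αxx t ζ - αxx t x) + δ * αxx t ζ := by rw [eβx]; ring
    have e2 : |δ * αxx t ζ| ≤ ε / 2 := by
      rw [abs_mul, abs_of_pos hδ0]
      refine (mul_le_mul_of_nonneg_left (Mαxx t ht ζ hζ) hδ0.le).trans ?_
      rw [hδ, one_div_mul_eq_div, div_le_iff₀ hτ0]
      exact g4
    have e3 := hmod t ht ζ hζ x hx (hζx.trans_lt hδℓ)
    rw [e1]
    refine (abs_add_le _ _).trans ?_
    rw [abs_neg]
    linarith
  have Bβxx : |βxx t x| ≤ ε / 2 * τ / ℓ := by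
    have m₁ := contract_mem hδ0 hδ1 hx
    have m₂ := contract_add_mem hδ0 hδ1 hx
    have hδℓ0 : 0 < δ * ℓ := mul_pos hδ0 hℓ
    have e3 := hmod t ht _ m₂ _ m₁ (by rwa [add_sub_cancel_left, abs_of_pos hδℓ0])
    have e4 : |shiftQuot δ ℓ αxx t x| ≤ ε / 2 * τ / ℓ := by
      rw [shiftQuot, abs_div, abs_of_pos hδℓ0, div_le_iff₀ hδℓ0]
      refine e3.le.trans (le_of_eq ?_)
      rw [hδ]; field_simp
    rw [hβxxe]
    simpa using abs_mul_le_mul h1δ (abs_mul_le_mul h1δ e4)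
  have Ba := Ma x hx
  have Ba₁ := Ma₁ x hx
  have Ba₂ := Ma₂ x hx
  have hM2 : M ≤ M ^ 4 := by
    simpa using pow_le_pow_right₀ hM (show 1 ≤ 4 by norm_num)
  have hM3 : M ^ 2 ≤ M ^ 4 := pow_le_pow_right₀ hM (by norm_num)
  have hM4 : M ^ 3 ≤ M ^ 4 := pow_le_pow_right₀ hM (by norm_num)
  have hM0' : 0 ≤ M ^ 4 := by positivity
  have hMℓ : 0 ≤ M ^ 2 * ℓ := by positivity
  have hH := hpos t ht x hx
  dsimp only
  refine ⟨?_, ?_, ?_, ?_, ?_, ?_, ?_, ?_⟩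
  · have b1 := abs_mul_le_mul (abs_mul_le_mul Ba Ba) Dβx
    have b2 := abs_mul_le_mul (abs_mul_le_mul Ba Ba₁) Dβε
    have b3 := (abs_le.1 b1).2
    have b4 := (abs_le.1 b2).2
    linarith
  · have b1 := (abs_le.1 (abs_mul_le_mul (Mαx t ht x hx) Dβε)).2
    have b2 : c₀ ^ 2 ≤ αx t x ^ 2 := by
      rw [← sq_abs (αx t x)]
      exact pow_le_pow_left₀ hc₀.le (hlb t ht x hx) 2
    have b3 : c₀ ^ 2 / 2 ≤ αx t x * β t x := by linarith
    have b4 := mul_le_mul b3 hH hc₀.le (by linarith [sq_nonneg c₀])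
    linarith
  · have b1 := abs_mul_le_mul Ba (((abs_add_le _ _).trans (add_le_add
      ((abs_add_le _ _).trans (add_le_add (abs_mul_le_mul Ba₂ Bβ) (abs_mul_le_mul Ba₁ Bβx)))
      ((abs_add_le _ _).trans (add_le_add (abs_mul_le_mul Ba₁ Bβx) (abs_mul_le_mul Ba Bβxx))))))
    refine b1.trans ?_
    have b2 : M ^ 2 * (ε / 2 * τ / ℓ) ≤ c / 8 * τ := by
      have : M ^ 2 * (ε / 2 * τ / ℓ) = (M ^ 2 * ε) * τ / ℓ / 2 := by ring
      rw [this]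
      have b3 : (M ^ 2 * ε) * τ / ℓ ≤ c / 8 * τ := by
        rw [div_le_iff₀ hℓ]
        linarith [mul_le_mul_of_nonneg_right hε₃ hτ0.le]
      have : 0 ≤ c / 8 * τ := by positivity
      linarith
    linarith
  · simp only [zero_mul, zero_add]
    have := abs_mul_le_mul Ms₂ (abs_mul_le_mul Ba Bβt)
    linarith
  · have := abs_mul_le_mul (abs_mul_le_mul (abs_mul_le_mul Ms₁ Ba) (Mαx t ht x hx))
      (Mαxt t ht x hx)
    linarith
  · have b1 := abs_mul_le_mul (abs_mul_le_mul (abs_of_pos hτ0).le Ba) Dβ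
    have b2 : τ * M * (M * (δ * ℓ)) = M ^ 2 * ℓ * (τ * δ) := by ring
    rw [b2, hδτ] at b1
    have b3 : 2 * τ * (a x * αx t x - a x * β t x) + a₁ x =
      2 * (τ * a x * (αx t x - β t x)) + a₁ x := by ring
    rw [b3]
    refine (abs_add_le _ _).trans ?_
    rw [abs_mul, abs_two]
    linarith
  · have b1 : |a x * αxx t x - (a₁ x * β t x + a x * βx t x) - s₁ * αt t x| ≤ 4 * M ^ 2 := by
      have := (abs_sub _ _).trans (add_le_add ((abs_sub _ _).trans (add_le_add
        (abs_mul_le_mul Ba (Mαxx t ht x hx)) ((abs_add_le _ _).trans (add_le_add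
        (abs_mul_le_mul Ba₁ Bβ) (abs_mul_le_mul Ba Bβx)))))
        (abs_mul_le_mul Ms₁ (Mαt t ht x hx)))
      linarith
    have b2 := (abs_add_le _ _).trans (add_le_add
      (abs_mul_le_mul (abs_of_pos hτ0).le b1) (Mp x hx))
    have b3 : M ≤ M ^ 4 * τ := hM2.trans (le_mul_of_one_le_right hM0' hτ1)
    have b4 : τ * (4 * M ^ 2) ≤ 4 * M ^ 4 * τ := by
      linarith [mul_le_mul_of_nonneg_left hM3 hτ0.le]
    have b5 : 0 ≤ M ^ 2 * ℓ * τ := by positivity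
    rw [hK]
    linarith
  · have b1 := abs_mul_le_mul (abs_mul_le_mul (abs_of_pos hτ0).le Ms₂) (Mαt t ht x hx)
    have b2 := mul_le_mul_of_nonneg_left hM3 hτ0.le
    have b3 : 0 ≤ M ^ 2 * ℓ * τ := by positivity
    have b4 : 0 ≤ M ^ 4 * τ := by positivity
    rw [hK]
    linarith

lemma DerivX.unique {T ℓ : ℝ} (hℓ : 0 < ℓ) {f g h : ℝ → ℝ → ℝ} (hg : DerivX T ℓ f g)
    (hh : DerivX T ℓ f h) {t x : ℝ} (ht : t ∈ Icc 0 T) (hx : x ∈ Icc 0 ℓ) : g t x = h t x :=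
  (uniqueDiffOn_Icc hℓ x hx).eq_deriv _ (hg t ht x hx) (hh t ht x hx)

lemma DerivX.congr {T ℓ : ℝ} {f g fx gx : ℝ → ℝ → ℝ} (hf : DerivX T ℓ f fx)
    (h : ∀ t ∈ Icc 0 T, ∀ x ∈ Icc 0 ℓ, g t x = f t x)
    (h' : ∀ t ∈ Icc 0 T, ∀ x ∈ Icc 0 ℓ, gx t x = fx t x) : DerivX T ℓ g gx := fun t ht x hx => by
  rw [h' t ht x hx]
  exact (hf t ht x hx).congr (fun y hy => h t ht y hy) (h t ht x hx)

lemma exists_isC1Rect {T ℓ : ℝ} (hT : 0 < T) (hℓ : 0 < ℓ) {m n : WithTop ℕ∞} {f : ℝ → ℝ → ℝ}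
    (hf : ContDiffOn ℝ n (fun z : ℝ × ℝ => f z.1 z.2) (Icc 0 T ×ˢ Icc 0 ℓ)) (hmn : m + 1 ≤ n) :
    ∃ ft fx : ℝ → ℝ → ℝ, IsC1Rect T ℓ f ft fx ∧
      ContDiffOn ℝ m (fun z : ℝ × ℝ => ft z.1 z.2) (Icc 0 T ×ˢ Icc 0 ℓ) ∧
      ContDiffOn ℝ m (fun z : ℝ × ℝ => fx z.1 z.2) (Icc 0 T ×ˢ Icc 0 ℓ) := by
  have hs : UniqueDiffOn ℝ (Icc 0 T ×ˢ Icc 0 ℓ) := (uniqueDiffOn_Icc hT).prod (uniqueDiffOn_Icc hℓ)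
  have h1 := hf.fderivWithin hs hmn
  have hd : ∀ t ∈ Icc 0 T, ∀ x ∈ Icc 0 ℓ, HasFDerivWithinAt (fun z : ℝ × ℝ => f z.1 z.2)
      (fderivWithin ℝ (fun z : ℝ × ℝ => f z.1 z.2) (Icc 0 T ×ˢ Icc 0 ℓ) (t, x))
      (Icc 0 T ×ˢ Icc 0 ℓ) (t, x) := fun t ht x hx =>
    (hf.differentiableOn (ne_of_gt (lt_of_lt_of_le (by simp) (le_trans le_add_self hmn)))
      (t, x) ⟨ht, hx⟩).hasFDerivWithinAt
  have ht := h1.clm_apply (contDiffOn_const (c := ((1, 0) : ℝ × ℝ)))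
  have hx := h1.clm_apply (contDiffOn_const (c := ((0, 1) : ℝ × ℝ)))
  refine ⟨fun t x => fderivWithin ℝ (fun z : ℝ × ℝ => f z.1 z.2) (Icc 0 T ×ˢ Icc 0 ℓ) (t, x) (1, 0),
    fun t x => fderivWithin ℝ (fun z : ℝ × ℝ => f z.1 z.2) (Icc 0 T ×ˢ Icc 0 ℓ) (t, x) (0, 1),
    ⟨fun t ht x hx => ?_, fun t ht x hx => ?_, hf.continuousOn, ht.continuousOn, hx.continuousOn⟩,
    ht, hx⟩
  · exact (hd t ht x hx).comp_hasDerivWithinAt (f := fun s => (s, x)) t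
      ((hasDerivWithinAt_id t _).prodMk (hasDerivWithinAt_const t _ x)) fun s hs => ⟨hs, hx⟩
  · exact (hd t ht x hx).comp_hasDerivWithinAt (f := fun y => (t, y)) x
      ((hasDerivWithinAt_const x _ t).prodMk (hasDerivWithinAt_id x _)) fun y hy => ⟨ht, hy⟩

lemma ContDiffOn.exists_hasDerivWithinAt {ℓ : ℝ} (hℓ : 0 < ℓ) {m n : WithTop ℕ∞} {a : ℝ → ℝ}
    (ha : ContDiffOn ℝ n a (Icc 0 ℓ)) (hmn : m + 1 ≤ n) :
    ∃ a₁ : ℝ → ℝ, (∀ x ∈ Icc 0 ℓ, HasDerivWithinAt a (a₁ x) (Icc 0 ℓ) x) ∧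
      ContDiffOn ℝ m a₁ (Icc 0 ℓ) :=
  ⟨derivWithin a (Icc 0 ℓ), fun x hx =>
    (ha.differentiableOn (ne_of_gt (lt_of_lt_of_le (by simp) (le_trans le_add_self hmn)))
      x hx).hasDerivWithinAt, ha.derivWithin (uniqueDiffOn_Icc hℓ) hmn⟩

/-- Differentiability data of `e^{τα} f` in terms of those of `f`. -/
lemma IsC1Rect.exp_mul {T ℓ τ : ℝ} {α αt αx αxx αxt f ft fx fxx : ℝ → ℝ → ℝ}
    (hα : IsC1Rect T ℓ α αt αx) (hαx : IsC1Rect T ℓ αx αxt αxx)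
    (hf : IsC1Rect T ℓ f ft fx) (hfx : DerivX T ℓ fx fxx) (hfxx : ContRect T ℓ fxx) :
    IsC1Rect T ℓ (fun t x => Real.exp (τ * α t x) * f t x)
        (fun t x => Real.exp (τ * α t x) * (ft t x + τ * αt t x * f t x))
        (fun t x => Real.exp (τ * α t x) * (fx t x + τ * αx t x * f t x)) ∧
      DerivX T ℓ (fun t x => Real.exp (τ * α t x) * (fx t x + τ * αx t x * f t x))
        (fun t x => Real.exp (τ * α t x) * (fxx t x + 2 * τ * αx t x * fx t x
          + (τ * αxx t x + τ ^ 2 * αx t x ^ 2) * f t x)) ∧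
      ContRect T ℓ (fun t x => Real.exp (τ * α t x) * (fxx t x + 2 * τ * αx t x * fx t x
          + (τ * αxx t x + τ ^ 2 * αx t x ^ 2) * f t x)) := by
  obtain ⟨dαt, dαx, cα, cαt, cαx⟩ := hα
  obtain ⟨-, dαxx, -, -, cαxx⟩ := hαx
  obtain ⟨dft, dfx, cf, cft, cfx⟩ := hf
  have cE : ContRect T ℓ fun t x => Real.exp (τ * α t x) := ((ContRect.const τ).mul cα).exp
  refine ⟨⟨fun t ht x hx => ?_, fun t ht x hx => ?_, cE.mul cf, ?_, ?_⟩, fun t ht x hx => ?_, ?_⟩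
  · exact (((dαt t ht x hx).const_mul τ).exp.fun_mul (dft t ht x hx)).congr_deriv (by ring)
  · exact (((dαx t ht x hx).const_mul τ).exp.fun_mul (dfx t ht x hx)).congr_deriv (by ring)
  · exact cE.mul (cft.add (((ContRect.const τ).mul cαt).mul cf))
  · exact cE.mul (cfx.add (((ContRect.const τ).mul cαx).mul cf))
  · exact (((dαx t ht x hx).const_mul τ).exp.fun_mul ((hfx t ht x hx).fun_add
      (((dαxx t ht x hx).const_mul τ).fun_mul (dfx t ht x hx)))).congr_deriv (by ring)
  · repeat' first
      | with_reducible assumption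
      | apply ContRect.pow
      | exact ContRect.const _
      | apply ContRect.add
      | apply ContRect.mul

lemma conjRe_exp_mul (s₁ s₂ τ a p αt αx αxx E u ut ux uxx v vt : ℝ) :
    conjRe s₁ s₂ τ a p αt αx αxx (E * u) (E * (ut + τ * αt * u)) (E * (ux + τ * αx * u))
      (E * (uxx + 2 * τ * αx * ux + (τ * αxx + τ ^ 2 * αx ^ 2) * u)) (E * v)
      (E * (vt + τ * αt * v)) = E * (s₁ * ut - s₂ * vt - a * uxx + p * u) := by
  unfold conjRe; ring

lemma conjIm_exp_mul (s₁ s₂ τ a p αt αx αxx E u ut v vt vx vxx : ℝ) :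
    conjIm s₁ s₂ τ a p αt αx αxx (E * u) (E * (ut + τ * αt * u)) (E * v)
      (E * (vt + τ * αt * v)) (E * (vx + τ * αx * v))
      (E * (vxx + 2 * τ * αx * vx + (τ * αxx + τ ^ 2 * αx ^ 2) * v))
      = E * (s₁ * vt + s₂ * ut - a * vxx + p * v) := by
  unfold conjIm; ring

lemma weighted_le_conjugated {τ β M E u ux v vx : ℝ} (hτ : 0 ≤ τ) (hβ : |β| ≤ M) :
    (τ * (ux ^ 2 + vx ^ 2) + τ ^ 3 * (u ^ 2 + v ^ 2)) * E ^ 2 ≤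
      (3 + 2 * M ^ 2) * (τ * ((E * (ux + τ * β * u)) ^ 2 + (E * (vx + τ * β * v)) ^ 2)
        + τ ^ 3 * ((E * u) ^ 2 + (E * v) ^ 2)) := by
  have hβ2 : β ^ 2 ≤ M ^ 2 := sq_le_sq' (by linarith [(abs_le.1 hβ).1]) (abs_le.1 hβ).2
  have h1 : 0 ≤ E ^ 2 * τ ^ 3 * (u ^ 2 + v ^ 2) * (M ^ 2 - β ^ 2) :=
    mul_nonneg (by positivity) (by linarith)
  have h2 : 0 ≤ E ^ 2 * τ * (1 + 2 * M ^ 2) *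
    ((ux + τ * β * u) ^ 2 + (vx + τ * β * v) ^ 2) := by positivity
  have h3 : 0 ≤ E ^ 2 * τ * ((ux + 2 * (τ * β * u)) ^ 2 + (vx + 2 * (τ * β * v)) ^ 2) := by
    positivity
  have h4 : 0 ≤ E ^ 2 * τ ^ 3 * (u ^ 2 + v ^ 2) := by positivity
  nlinarith [h1, h2, h3, h4]

lemma IsC12.isC1Rect_re {T ℓ : ℝ} {z zt zx zxx : ℝ → ℝ → ℂ} (hz : IsC12 T ℓ z zt zx zxx) :
    IsC1Rect T ℓ (fun t x => (z t x).re) (fun t x => (zt t x).re) (fun t x => (zx t x).re) ∧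
      DerivX T ℓ (fun t x => (zx t x).re) (fun t x => (zxx t x).re) ∧
      ContRect T ℓ (fun t x => (zxx t x).re) := by
  obtain ⟨hd, h0, h1, h2, h3⟩ := hz
  have key := fun (f : ℝ → ℂ) f' (s : Set ℝ) x (h : HasDerivWithinAt f f' s x) =>
    Complex.reCLM.hasFDerivAt.comp_hasDerivWithinAt x h
  exact ⟨⟨fun t ht x hx => key _ _ _ _ (hd t ht x hx).1,
    fun t ht x hx => key _ _ _ _ (hd t ht x hx).2.1, Complex.continuous_re.comp_continuousOn h0,
    Complex.continuous_re.comp_continuousOn h1, Complex.continuous_re.comp_continuousOn h2⟩,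
    fun t ht x hx => key _ _ _ _ (hd t ht x hx).2.2, Complex.continuous_re.comp_continuousOn h3⟩

lemma IsC12.isC1Rect_im {T ℓ : ℝ} {z zt zx zxx : ℝ → ℝ → ℂ} (hz : IsC12 T ℓ z zt zx zxx) :
    IsC1Rect T ℓ (fun t x => (z t x).im) (fun t x => (zt t x).im) (fun t x => (zx t x).im) ∧
      DerivX T ℓ (fun t x => (zx t x).im) (fun t x => (zxx t x).im) ∧
      ContRect T ℓ (fun t x => (zxx t x).im) := by
  obtain ⟨hd, h0, h1, h2, h3⟩ := hz
  have key := fun (f : ℝ → ℂ) f' (s : Set ℝ) x (h : HasDerivWithinAt f f' s x) =>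
    Complex.imCLM.hasFDerivAt.comp_hasDerivWithinAt x h
  exact ⟨⟨fun t ht x hx => key _ _ _ _ (hd t ht x hx).1,
    fun t ht x hx => key _ _ _ _ (hd t ht x hx).2.1, Complex.continuous_im.comp_continuousOn h0,
    Complex.continuous_im.comp_continuousOn h1, Complex.continuous_im.comp_continuousOn h2⟩,
    fun t ht x hx => key _ _ _ _ (hd t ht x hx).2.2, Complex.continuous_im.comp_continuousOn h3⟩

lemma IsC12.derivX_eq_zero {T ℓ : ℝ} (hℓ : 0 < ℓ) {z zt zx zxx : ℝ → ℝ → ℂ}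
    (hz : IsC12 T ℓ z zt zx zxx) {t : ℝ} (ht : t ∈ Icc 0 T) (h : ∀ x ∈ Icc 0 ℓ, z t x = 0)
    {x : ℝ} (hx : x ∈ Icc 0 ℓ) : zx t x = 0 :=
  (uniqueDiffOn_Icc hℓ x hx).eq_deriv _ (hz.1 t ht x hx).2.1
    ((hasDerivWithinAt_const x _ (0:ℂ)).congr h (h x hx))

lemma carleman_weighted {T ℓ : ℝ} (hℓ : 0 < ℓ) (hT : 0 < T) {σ : ℂ} {τ c K M : ℝ}
    {a a₁ p : ℝ → ℝ} {α αt αx αxx αxt b bt bx bxx : ℝ → ℝ → ℝ}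
    (hτ : 1 ≤ τ) (hc : 0 < c) (hK : 0 ≤ K) (hcK : 4 * K + 16 * K ^ 2 ≤ c * τ)
    (ha : ∀ x ∈ Icc (0:ℝ) ℓ, HasDerivWithinAt a (a₁ x) (Icc 0 ℓ) x)
    (ha₁ : ContinuousOn a₁ (Icc 0 ℓ)) (hp : ContinuousOn p (Icc 0 ℓ))
    (hα : IsC1Rect T ℓ α αt αx) (hαx : IsC1Rect T ℓ αx αxt αxx)
    (Mαx : ∀ t ∈ Icc 0 T, ∀ x ∈ Icc 0 ℓ, |αx t x| ≤ M)
    (hb : IsC1Rect T ℓ b bt bx) (hbx : DerivX T ℓ bx bxx) (hbxx : ContRect T ℓ bxx)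
    (h : ∀ t ∈ Icc 0 T, ∀ x ∈ Icc 0 ℓ, c ≤ 2 * a x * bx t x - a₁ x * b t x ∧
        c ≤ (2 * a x * αx t x * αxx t x + a₁ x * αx t x ^ 2) * b t x ∧
        |a x * bxx t x| ≤ c / 4 * τ ∧ |σ.im * bt t x| ≤ K ∧
        |σ.re * a x * αx t x * αxt t x| ≤ K ∧
        |2 * τ * (a x * αx t x - b t x) + a₁ x| ≤ K ∧
        |τ * (a x * αxx t x - bx t x - σ.re * αt t x) + p x| ≤ K * τ ∧
        |τ * σ.im * αt t x| ≤ K * τ)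
    {z zt zx zxx : ℝ → ℝ → ℂ} (hz : IsC12 T ℓ z zt zx zxx)
    (hzℓ : ∀ t ∈ Icc (0:ℝ) T, z t 0 = 0 ∧ z t ℓ = 0 ∧ zx t 0 = 0 ∧ zx t ℓ = 0)
    (hzT : ∀ x ∈ Icc (0:ℝ) ℓ, z 0 x = 0 ∧ z T x = 0) :
    (∫ w in Ioo (0:ℝ) T ×ˢ Ioo (0:ℝ) ℓ,
        (τ * ‖zx w.1 w.2‖ ^ 2 + τ ^ 3 * ‖z w.1 w.2‖ ^ 2) * Real.exp (2 * τ * α w.1 w.2))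
      ≤ 2 * (3 + 2 * M ^ 2) / c * ∫ w in Ioo (0:ℝ) T ×ˢ Ioo (0:ℝ) ℓ,
          ‖σ * zt w.1 w.2 - (a w.2 : ℂ) * zxx w.1 w.2 + (p w.2 : ℂ) * z w.1 w.2‖ ^ 2
            * Real.exp (2 * τ * α w.1 w.2) := by
  obtain ⟨hr, hrx, hrxx⟩ := hz.isC1Rect_re
  obtain ⟨hi, hix, hixx⟩ := hz.isC1Rect_im
  obtain ⟨hu, hux, huxx⟩ := hα.exp_mul (τ := τ) hαx hr hrx hrxx
  obtain ⟨hv, hvx, hvxx⟩ := hα.exp_mul (τ := τ) hαx hi hix hixx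
  have hτ0 : 0 ≤ τ := by linarith
  have h00 : (0:ℝ) ∈ Icc 0 T := ⟨le_rfl, hT.le⟩
  have hTT : T ∈ Icc 0 T := ⟨hT.le, le_rfl⟩
  have zx0 := fun x hx => hz.derivX_eq_zero hℓ h00 (fun x hx => (hzT x hx).1) (x := x) hx
  have zxT := fun x hx => hz.derivX_eq_zero hℓ hTT (fun x hx => (hzT x hx).2) (x := x) hx
  have main := carleman_conjugated hℓ.le hT.le (s₁ := σ.re) (s₂ := σ.im) hτ hK hcK ha ha₁ hp
    hα.contT hαx hb hbx hbxx hu hux huxx hv hvx hvxx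
    (fun t ht => by simp [hzℓ t ht]) (fun t ht => by simp [hzℓ t ht])
    (fun t ht => by simp [hzℓ t ht]) (fun t ht => by simp [hzℓ t ht])
    (fun t ht => by simp [hzℓ t ht]) (fun t ht => by simp [hzℓ t ht])
    (fun t ht => by simp [hzℓ t ht]) (fun t ht => by simp [hzℓ t ht])
    (fun x hx => by simp [hzT x hx]) (fun x hx => by simp [hzT x hx])
    (fun x hx => by simp [hzT x hx, zx0 x hx]) (fun x hx => by simp [hzT x hx, zxT x hx])
    (fun x hx => by simp [hzT x hx]) (fun x hx => by simp [hzT x hx])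
    (fun x hx => by simp [hzT x hx, zx0 x hx]) (fun x hx => by simp [hzT x hx, zxT x hx])
    (fun t ht x hx => (h t ht x hx).1) (fun t ht x hx => (h t ht x hx).2.1)
    (fun t ht x hx => (h t ht x hx).2.2.1) (fun t ht x hx => (h t ht x hx).2.2.2.1)
    (fun t ht x hx => (h t ht x hx).2.2.2.2.1) (fun t ht x hx => (h t ht x hx).2.2.2.2.2.1)
    (fun t ht x hx => (h t ht x hx).2.2.2.2.2.2.1) (fun t ht x hx => (h t ht x hx).2.2.2.2.2.2.2)
  simp only [conjRe_exp_mul, conjIm_exp_mul] at main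
  have hE : ∀ t x, Real.exp (2 * τ * α t x) = Real.exp (τ * α t x) ^ 2 := fun t x => by
    rw [← Real.exp_nat_mul]; push_cast; ring_nf
  have hP : ∀ t x, ‖σ * zt t x - (a x : ℂ) * zxx t x + (p x : ℂ) * z t x‖ ^ 2
      * Real.exp (2 * τ * α t x) =
      (Real.exp (τ * α t x) * (σ.re * (zt t x).re - σ.im * (zt t x).im - a x * (zxx t x).re
        + p x * (z t x).re)) ^ 2
      + (Real.exp (τ * α t x) * (σ.re * (zt t x).im + σ.im * (zt t x).re - a x * (zxx t x).im
        + p x * (z t x).im)) ^ 2 := fun t x => by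
    rw [hE, Complex.sq_norm, Complex.normSq_apply]
    simp only [Complex.add_re, Complex.sub_re, Complex.mul_re, Complex.add_im, Complex.sub_im,
      Complex.mul_im, Complex.ofReal_re, Complex.ofReal_im]
    ring
  simp only [hP]
  have hcE : ContRect T ℓ fun t x => Real.exp (τ * α t x) := ((ContRect.const τ).mul hα.cont).exp
  have hint₁ : ContRect T ℓ fun t x => (τ * ‖zx t x‖ ^ 2 + τ ^ 3 * ‖z t x‖ ^ 2)
      * Real.exp (2 * τ * α t x) := by
    have hn : ContRect T ℓ fun t x => ‖zx t x‖ := hz.2.2.2.1.norm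
    have hn' : ContRect T ℓ fun t x => ‖z t x‖ := hz.2.1.norm
    simp only [hE]
    exact (((ContRect.const τ).mul (hn.pow 2)).add ((ContRect.const _).mul (hn'.pow 2))).mul
      (hcE.pow 2)
  have hint₂ := ((ContRect.const τ).mul ((hu.contX.pow 2).add (hv.contX.pow 2))).add
    ((ContRect.const (τ ^ 3)).mul ((hu.cont.pow 2).add (hv.cont.pow 2)))
  have hle := setIntegral_mono_on hint₁.integrableOn
    (((ContRect.const (3 + 2 * M ^ 2)).mul hint₂).integrableOn)
    (measurableSet_Ioo.prod measurableSet_Ioo) fun w hw => by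
      have hw1 := Ioo_subset_Icc_self hw.1
      have hw2 := Ioo_subset_Icc_self hw.2
      have := weighted_le_conjugated (E := Real.exp (τ * α w.1 w.2)) (u := (z w.1 w.2).re)
        (ux := (zx w.1 w.2).re) (v := (z w.1 w.2).im) (vx := (zx w.1 w.2).im)
        hτ0 (Mαx _ hw1 _ hw2)
      simpa only [hE, Complex.sq_norm, Complex.normSq_apply, ← sq] using this
  refine hle.trans ?_
  rw [MeasureTheory.integral_const_mul, mul_comm (2:ℝ) (3 + 2 * M ^ 2), mul_div_assoc, mul_assoc]
  refine mul_le_mul_of_nonneg_left ?_ (by positivity)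
  rw [div_mul_eq_mul_div, le_div_iff₀' hc]
  exact main

/-- Positivity of the pseudoconvexity expression for the weight `e^{λψ}`. -/
lemma convexified_weight_lower_bound {a a₁ y yx lam m N C e α : ℝ} (hm : 0 < m) (ha : m ≤ a)
    (hC : 0 < C) (hy : C ≤ |y|) (hlam : 0 < lam) (hN : |2 * a * yx + a₁ * y| ≤ N)
    (hlamN : N + 1 ≤ 2 * m * C ^ 2 * lam) (he : 0 ≤ e) (hα : e ≤ α) :
    lam * m * e ≤ 2 * a ^ 2 * ((lam * yx + lam ^ 2 * y ^ 2) * α) + a * a₁ * (lam * y * α) := by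
  have ha0 : 0 ≤ a := hm.le.trans ha
  have hα0 : 0 ≤ α := he.trans hα
  have hy2 : C ^ 2 ≤ y ^ 2 := by rw [← sq_abs y]; gcongr
  have h1 : 2 * m * C ^ 2 * lam ≤ 2 * a * y ^ 2 * lam := by gcongr
  have h2 : 1 ≤ 2 * a * y ^ 2 * lam + (2 * a * yx + a₁ * y) := by
    linarith [(abs_le.1 hN).1]
  calc lam * m * e = lam * m * e * 1 := by ring
    _ ≤ lam * a * α * (2 * a * y ^ 2 * lam + (2 * a * yx + a₁ * y)) := by gcongr
    _ = _ := by ring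

/-- The Carleman estimate (Lemma 4) with weight `α = e^{λψ}` for the operator
`P z = σ∂ₜz − a(x)∂ₓ²z + p(x)z`, for functions vanishing on `∂Q` together with
their `x`-derivative on the lateral boundary. -/
theorem stmt_7
    (T ℓ : ℝ) (hT : 0 < T) (hℓ : 0 < ℓ)
    (σ : ℂ) (hσ : σ ≠ 0)
    (p a : ℝ → ℝ)
    (hp : ContDiffOn ℝ 1 p (Icc 0 ℓ))
    (ha : ContDiffOn ℝ 2 a (Icc 0 ℓ)) (hapos : ∀ x ∈ Icc (0:ℝ) ℓ, 0 < a x)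
    (ψ ψx : ℝ → ℝ → ℝ)
    (hψ : ContDiffOn ℝ 2 (fun z : ℝ × ℝ => ψ z.1 z.2) (Icc 0 T ×ˢ Icc 0 ℓ))
    (hψx : ∀ t ∈ Icc (0:ℝ) T, ∀ x ∈ Icc (0:ℝ) ℓ,
      HasDerivWithinAt (fun y => ψ t y) (ψx t x) (Icc 0 ℓ) x)
    (C : ℝ) (hC : 0 < C)
    (hψlb : ∀ t ∈ Icc (0:ℝ) T, ∀ x ∈ Icc (0:ℝ) ℓ, C ≤ |ψx t x|) :
    ∃ lamh > (0:ℝ), ∀ lam ≥ lamh, ∃ τ₀ > (0:ℝ), ∃ C₁ > (0:ℝ), ∀ τ ≥ τ₀,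
      ∀ z zt zx zxx : ℝ → ℝ → ℂ, IsC12 T ℓ z zt zx zxx →
        (∀ t ∈ Icc (0:ℝ) T, z t 0 = 0 ∧ z t ℓ = 0 ∧ zx t 0 = 0 ∧ zx t ℓ = 0) →
        (∀ x ∈ Icc (0:ℝ) ℓ, z 0 x = 0 ∧ z T x = 0) →
        (∫ w in Ioo (0:ℝ) T ×ˢ Ioo (0:ℝ) ℓ,
            (τ * ‖zx w.1 w.2‖ ^ 2 + τ ^ 3 * ‖z w.1 w.2‖ ^ 2)
              * Real.exp (2 * τ * Real.exp (lam * ψ w.1 w.2)))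
          ≤ C₁ * ∫ w in Ioo (0:ℝ) T ×ˢ Ioo (0:ℝ) ℓ,
              ‖σ * zt w.1 w.2 - (a w.2 : ℂ) * zxx w.1 w.2 + (p w.2 : ℂ) * z w.1 w.2‖ ^ 2
                * Real.exp (2 * τ * Real.exp (lam * ψ w.1 w.2)) := by
  obtain ⟨a₁, ha₁, ca₁⟩ := ha.exists_hasDerivWithinAt hℓ (m := 1) (by norm_num)
  obtain ⟨a₂, ha₂, ca₂⟩ := ca₁.exists_hasDerivWithinAt hℓ (m := 0) (by norm_num)
  obtain ⟨ψt, ψy, dψ, -, hψy⟩ := exists_isC1Rect hT hℓ (m := 1) hψ (by norm_num)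
  obtain ⟨ψyt, ψyx, dψy, -, -⟩ := exists_isC1Rect hT hℓ (m := 0) hψy (by norm_num)
  have hlb : ∀ t ∈ Icc 0 T, ∀ x ∈ Icc 0 ℓ, C ≤ |ψy t x| := fun t ht x hx => by
    rw [dψ.derivX.unique hℓ hψx ht hx]; exact hψlb t ht x hx
  have Ha := ContRect.of_space (T := T) ha.continuousOn
  have Ha₁ := ContRect.of_space (T := T) ca₁.continuousOn
  have Ha₂ := ContRect.of_space (T := T) ca₂.continuousOn
  have Hp := ContRect.of_space (T := T) hp.continuousOn
  have h0T : (0:ℝ) ∈ Icc 0 T := ⟨le_rfl, hT.le⟩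
  obtain ⟨x₀, hx₀, hmin⟩ := isCompact_Icc.exists_isMinOn (nonempty_Icc.2 hℓ.le) ha.continuousOn
  obtain ⟨m, hm⟩ : ∃ m, m = a x₀ := ⟨_, rfl⟩
  have hm0 : 0 < m := hm ▸ hapos x₀ hx₀
  have hma : ∀ x ∈ Icc 0 ℓ, m ≤ a x := fun x hx => hm ▸ isMinOn_iff.1 hmin x hx
  obtain ⟨N, hN0, hN⟩ := ((((ContRect.const 2).mul Ha).mul dψy.contX).add
    (Ha₁.mul dψ.contX)).exists_bound
  obtain ⟨Kψ, -, hKψ⟩ := dψ.cont.exists_bound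
  refine ⟨(N + 1) / (2 * m * C ^ 2), by positivity, fun lam hlam => ?_⟩
  have hlam0 : 0 < lam := lt_of_lt_of_le (by positivity) hlam
  have hlamN : N + 1 ≤ 2 * m * C ^ 2 * lam := (div_le_iff₀' (by positivity)).1 hlam
  obtain ⟨αt, αx, dα, hαt, hαx⟩ := exists_isC1Rect hT hℓ (m := 1) (n := 2)
    (f := fun t x => Real.exp (lam * ψ t x)) (contDiffOn_const.mul hψ).exp (by norm_num)
  obtain ⟨αtt, αtx, dαt, -, -⟩ := exists_isC1Rect hT hℓ (m := 0) hαt (by norm_num)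
  obtain ⟨αxt, αxx, dαx, -, -⟩ := exists_isC1Rect hT hℓ (m := 0) hαx (by norm_num)
  have d₁ : DerivX T ℓ (fun t x => Real.exp (lam * ψ t x))
      fun t x => lam * ψy t x * Real.exp (lam * ψ t x) := fun t ht x hx =>
    ((dψ.derivX t ht x hx).const_mul lam).exp.congr_deriv (by ring)
  have e₁ : ∀ t ∈ Icc 0 T, ∀ x ∈ Icc 0 ℓ, αx t x = lam * ψy t x * Real.exp (lam * ψ t x) :=
    fun t ht x hx => dα.derivX.unique hℓ d₁ ht hx
  have d₂ : DerivX T ℓ (fun t x => lam * ψy t x * Real.exp (lam * ψ t x))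
      fun t x => (lam * ψyx t x + lam ^ 2 * ψy t x ^ 2) * Real.exp (lam * ψ t x) :=
    fun t ht x hx => (((dψy.derivX t ht x hx).const_mul lam).fun_mul (d₁ t ht x hx)).congr_deriv
      (by ring)
  have e₂ : ∀ t ∈ Icc 0 T, ∀ x ∈ Icc 0 ℓ,
      αxx t x = (lam * ψyx t x + lam ^ 2 * ψy t x ^ 2) * Real.exp (lam * ψ t x) :=
    fun t ht x hx => dαx.derivX.unique hℓ (d₂.congr e₁ fun _ _ _ _ => rfl) ht hx
  have hexp : ∀ t ∈ Icc 0 T, ∀ x ∈ Icc 0 ℓ,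
      Real.exp (-(lam * Kψ)) ≤ Real.exp (lam * ψ t x) := fun t ht x hx => by
    rw [← mul_neg]
    gcongr
    exact (abs_le.1 (hKψ t ht x hx)).1
  obtain ⟨B₁, B₁0, hB₁⟩ := Ha.exists_bound
  obtain ⟨B₂, B₂0, hB₂⟩ := Ha₁.exists_bound
  obtain ⟨B₃, B₃0, hB₃⟩ := Ha₂.exists_bound
  obtain ⟨B₄, B₄0, hB₄⟩ := Hp.exists_bound
  obtain ⟨B₅, B₅0, hB₅⟩ := dα.contT.exists_bound
  obtain ⟨B₆, B₆0, hB₆⟩ := dα.contX.exists_bound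
  obtain ⟨B₇, B₇0, hB₇⟩ := dαx.contX.exists_bound
  obtain ⟨B₈, B₈0, hB₈⟩ := dαx.contT.exists_bound
  obtain ⟨B₉, B₉0, hB₉⟩ := dαt.contX.exists_bound
  have hσ₁ := abs_nonneg σ.re
  have hσ₂ := abs_nonneg σ.im
  obtain ⟨M, hM⟩ : ∃ M, M = 1 + B₁ + B₂ + B₃ + B₄ + B₅ + B₆ + B₇ + B₈ + B₉ + |σ.re| + |σ.im| :=
    ⟨_, rfl⟩
  have Mαx : ∀ t ∈ Icc 0 T, ∀ x ∈ Icc 0 ℓ, |αx t x| ≤ M :=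
    fun t ht x hx => (hB₆ t ht x hx).trans (by linarith)
  obtain ⟨c, hc, K, hK, τ₀, hτ₀, H⟩ := exists_multiplier (T := T) (p := p) (M := M)
    (c₀ := lam * min m C * Real.exp (-(lam * Kψ))) (s₁ := σ.re) (s₂ := σ.im) hℓ (by positivity)
    (by linarith) ha₁ ha₂ ca₂.continuousOn dα dαx dαt.derivX
    (fun x hx => (hB₁ 0 h0T x hx).trans (by linarith))
    (fun x hx => (hB₂ 0 h0T x hx).trans (by linarith))
    (fun x hx => (hB₃ 0 h0T x hx).trans (by linarith))
    (fun x hx => (hB₄ 0 h0T x hx).trans (by linarith))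
    (fun t ht x hx => (hB₅ t ht x hx).trans (by linarith)) Mαx
    (fun t ht x hx => (hB₇ t ht x hx).trans (by linarith))
    (fun t ht x hx => (hB₈ t ht x hx).trans (by linarith))
    (fun t ht x hx => (hB₉ t ht x hx).trans (by linarith)) (by linarith) (by linarith)
    (fun t ht x hx => by
      rw [e₁ t ht x hx, abs_mul, abs_mul, abs_of_pos hlam0, Real.abs_exp]
      have h1 := hlb t ht x hx
      have h2 := hexp t ht x hx
      have h3 : min m C ≤ |ψy t x| := (min_le_right _ _).trans h1
      gcongr)
    (fun t ht x hx => by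
      have h1 := convexified_weight_lower_bound hm0 (hma x hx) hC (hlb t ht x hx) hlam0
        (hN t ht x hx) hlamN (Real.exp_nonneg _) (hexp t ht x hx)
      rw [e₁ t ht x hx, e₂ t ht x hx]
      refine le_trans ?_ h1
      gcongr
      exact min_le_left _ _)
  refine ⟨τ₀, by linarith, 2 * (3 + 2 * M ^ 2) / c, by positivity, fun τ hτ => ?_⟩
  obtain ⟨hcK, b, bt, bx, bxx, hb, hbx, hbxx, h⟩ := H τ hτ
  exact fun z zt zx zxx hz hzℓ hzT => carleman_weighted hℓ hT (hτ₀.trans hτ) hc hK hcK ha₁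
    ca₁.continuousOn hp.continuousOn dα dαx Mαx hb hbx hbxx h hz hzℓ hzT
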